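/- arXiv:math/0402310 — 4 statements merged into one kernel-verified Lean document; each statement's English description precedes it below -/
import Mathlib

section
/- Let R be a commutative Noetherian ring, and let M and N be finitely generated R-modules such that M has finite projective dimension. Then for every integer i ≥ 0, dim_R Ext^i_R(M,N) + i ≤ dim R; that is, whenever Ext^i_R(M,N) ≠ 0 one has dim_R Ext^i_R(M,N) ≤ dim R - i. (This is the module case of Theorem 2.1(i): dim RHom_R(X,Y) ≤ dim R + sup X - inf Y when proj.dim X < ∞.) -/
/-!
Common definitions: Ext modules, dimension of a module (Krull dimension of its
support, in `WithBot ℕ∞`, with `⊥` for the zero module), projective/injective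
dimension via the Ext-vanishing characterization, and cohomological dimension
with respect to an ideal via local cohomology.
-/

open CategoryTheory TensorProduct

universe u

/-- The `i`-th Ext module `Ext^i_R(M, N)` of two `R`-modules. -/
noncomputable def extMod (R : Type u) [CommRing R] (i : ℕ) (M N : ModuleCat.{u} R) :
    ModuleCat.{u} R :=
  ((Ext R (ModuleCat.{u} R) i).obj (Opposite.op M)).obj N

/-- The dimension `dim_R M` of an `R`-module: the Krull dimension of its support
`Supp_R M ⊆ Spec R`, an element of `WithBot ℕ∞` which is `⊥ = -∞` for the zero module. -/
noncomputable def supportDim (R : Type u) [CommRing R] (M : Type u) [AddCommGroup M]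
    [Module R M] : WithBot ℕ∞ :=
  Order.krullDim (Module.support R M)

/-- `M` has projective dimension at most `n`: `Ext^{n+1}_R(M, N) = 0` for every `N`. -/
def projDimLE (R : Type u) [CommRing R] (M : ModuleCat.{u} R) (n : ℕ) : Prop :=
  ∀ N : ModuleCat.{u} R, Subsingleton (extMod R (n + 1) M N)

/-- The projective dimension `proj.dim_R M`, as an element of `WithBot ℕ∞`
(it is `⊤` when `M` does not have finite projective dimension). -/
noncomputable def projDim (R : Type u) [CommRing R] (M : ModuleCat.{u} R) : WithBot ℕ∞ :=
  sInf {d : WithBot ℕ∞ | ∃ n : ℕ, d = n ∧ projDimLE R M n}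

/-- `N` has injective dimension at most `n`: `Ext^{n+1}_R(M, N) = 0` for every `M`. -/
def injDimLE (R : Type u) [CommRing R] (N : ModuleCat.{u} R) (n : ℕ) : Prop :=
  ∀ M : ModuleCat.{u} R, Subsingleton (extMod R (n + 1) M N)

/-- The cohomological dimension `cd(a, M)`: the supremum of those `i` with
`H^i_a(M) ≠ 0`, an element of `WithBot ℕ∞` which is `⊥ = -∞` when all the local
cohomology modules vanish. -/
noncomputable def cohDim (R : Type u) [CommRing R] (a : Ideal R) (M : ModuleCat.{u} R) :
    WithBot ℕ∞ :=
  ⨆ i ∈ {i : ℕ | ¬ Subsingleton ((localCohomology a i).obj M)}, (i : WithBot ℕ∞)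

open IsLocalRing

/-- A finite module over a local ring is a quotient of a finite free module by a submodule
of vectors with coordinates in the maximal ideal. -/
theorem IsLocalRing.exists_minimal_cover {R : Type u} [CommRing R] [IsLocalRing R] (M : Type u)
    [AddCommGroup M] [Module R M] [Module.Finite R M] :
    ∃ (n : ℕ) (f : (Fin n → R) →ₗ[R] M), Function.Surjective f ∧
      ∀ x, f x = 0 → ∀ i, x i ∈ maximalIdeal R := by
  classical
  have hex : ∃ n : ℕ, ∃ f : (Fin n → R) →ₗ[R] M, Function.Surjective f :=
    Module.Finite.exists_fin' R M
  obtain ⟨f, hf⟩ := Nat.find_spec hex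
  refine ⟨_, f, hf, fun x hx i ↦ ?_⟩
  by_contra hi
  have hu : IsUnit (x i) := by simpa using hi
  obtain ⟨m, hm⟩ : ∃ m, Nat.find hex = m + 1 :=
    Nat.exists_eq_succ_of_ne_zero (by have := i.2; omega)
  have hmin := Nat.find_min hex (m := m) (by omega)
  revert f x i hmin
  rw [hm]
  intro f hf x hx i hi hu hmin
  apply hmin
  obtain ⟨u, hu⟩ := hu
  refine ⟨f ∘ₗ LinearMap.pi fun j ↦
    if h : ∃ l, i.succAbove l = j then LinearMap.proj h.choose else 0, ?_⟩
  intro y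
  obtain ⟨z, rfl⟩ := hf y
  let w : Fin (m + 1) → R := z - ((↑u⁻¹ : R) * z i) • x
  refine ⟨fun l ↦ w (i.succAbove l), ?_⟩
  have : f w = f z := by simp [w, hx]
  rw [← this]
  simp only [LinearMap.comp_apply]
  congr 1
  ext j
  simp only [LinearMap.pi_apply]
  split_ifs with h
  · simp only [LinearMap.proj_apply, h.choose_spec]
  · have : j = i := by
      by_contra hne
      exact h (Fin.exists_succAbove_eq hne)
    subst this
    simp only [LinearMap.zero_apply, w, Pi.sub_apply, Pi.smul_apply, smul_eq_mul, ← hu]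
    rw [mul_right_comm]
    simp

/-- A map between finite free modules with matrix entries in `J` acts as zero on `Ext k _`
whenever `J` annihilates `k`. -/
theorem ext_comp_eq_zero {R : Type u} [CommRing R] {J : Ideal R} {k : ModuleCat.{u} R}
    (hk : ∀ a ∈ J, a • 𝟙 k = 0) {K : ModuleCat.{u} R} [Module.Finite R K] [Module.Free R K] {n : ℕ}
    (g : K →ₗ[R] (Fin n → R)) (hg : ∀ x i, g x i ∈ J) {t : ℕ} (e : Abelian.Ext k K t) :
    e.comp (Abelian.Ext.mk₀ (ModuleCat.ofHom g)) (add_zero t) = 0 := by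
  classical
  have hJ (a : R) (ha : a ∈ J) {L : ModuleCat.{u} R} (e : Abelian.Ext k L t) : a • e = 0 := by
    rw [← e.mk₀_id_comp, ← Abelian.Ext.smul_comp, ← Abelian.Ext.mk₀_smul, hk a ha]
    simp
  let b := Module.Free.chooseBasis R K
  have hsum : g = ∑ j, ∑ i, g (b j) i • (b.coord j).smulRight (Pi.single i (1 : R)) := by
    apply b.ext
    intro l
    ext i
    rw [LinearMap.sum_apply, Finset.sum_eq_single l (by simp +contextual)
      (by simp), LinearMap.sum_apply, Finset.sum_apply, Finset.sum_eq_single i]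
    · simp
    · intro j _ hj
      simp [hj.symm]
    · simp
  let T : (K →ₗ[R] (Fin n → R)) →+ Abelian.Ext k (ModuleCat.of R (Fin n → R)) t :=
    { toFun g := e.comp (Abelian.Ext.mk₀ (ModuleCat.ofHom g)) (add_zero t)
      map_zero' := by simp
      map_add' f g := by simp [ModuleCat.ofHom_add, Abelian.Ext.mk₀_add] }
  change T g = 0
  rw [hsum, map_sum]
  refine Finset.sum_eq_zero fun j _ ↦ ?_
  rw [map_sum]
  refine Finset.sum_eq_zero fun i _ ↦ ?_
  have hsmul : T (g (b j) i • (b.coord j).smulRight (Pi.single i 1)) =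
      g (b j) i • T ((b.coord j).smulRight (Pi.single i 1)) := by
    simp only [T, AddMonoidHom.coe_mk, ZeroHom.coe_mk]
    rw [← Abelian.Ext.comp_smul, ← Abelian.Ext.mk₀_smul]
    rfl
  rw [hsmul]
  exact hJ _ (hg _ _) _

theorem subsingleton_ext_pi {R : Type u} [CommRing R] {k : ModuleCat.{u} R} {t : ℕ}
    (h : Subsingleton (Abelian.Ext k (ModuleCat.of R R) t)) (n : ℕ) :
    Subsingleton (Abelian.Ext k (ModuleCat.of R (Fin n → R)) t) := by
  classical
  refine subsingleton_of_forall_eq 0 fun e ↦ ?_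
  have hid : 𝟙 (ModuleCat.of R (Fin n → R)) = ∑ i, ModuleCat.ofHom (LinearMap.proj i) ≫
      ModuleCat.ofHom (LinearMap.single R (fun _ : Fin n ↦ R) i) := by
    ext : 1
    rw [ModuleCat.hom_sum]
    refine LinearMap.ext fun x ↦ ?_
    ext j
    simp [Pi.single_apply]
  rw [← e.comp_mk₀_id, hid, Abelian.Ext.mk₀_sum, Abelian.Ext.comp_sum]
  refine Finset.sum_eq_zero fun i _ ↦ ?_
  rw [← Abelian.Ext.mk₀_comp_mk₀, ← Abelian.Ext.comp_assoc_of_third_deg_zero,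
    Subsingleton.elim (e.comp _ _) 0, Abelian.Ext.zero_comp]

theorem nontrivial_ext_of_free {R : Type u} [CommRing R] {k : ModuleCat.{u} R} {t : ℕ}
    (h : Nontrivial (Abelian.Ext k (ModuleCat.of R R) t)) (K : ModuleCat.{u} R) [Module.Free R K]
    [Nontrivial K] : Nontrivial (Abelian.Ext k K t) := by
  obtain ⟨e, he⟩ := exists_ne (0 : Abelian.Ext k (ModuleCat.of R R) t)
  let b := Module.Free.chooseBasis R K
  obtain ⟨j⟩ := b.index_nonempty
  refine ⟨e.comp (Abelian.Ext.mk₀ (ModuleCat.ofHom (LinearMap.toSpanSingleton R K (b j))))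
    (add_zero t), 0, fun h0 ↦ he ?_⟩
  have hid : ModuleCat.ofHom (LinearMap.toSpanSingleton R K (b j)) ≫ ModuleCat.ofHom (b.coord j) =
      𝟙 (ModuleCat.of R R) := by
    ext
    simp
  rw [← e.comp_mk₀_id, ← hid, ← Abelian.Ext.mk₀_comp_mk₀,
    ← Abelian.Ext.comp_assoc_of_third_deg_zero, h0, Abelian.Ext.zero_comp]

/-- If `k` is annihilated by the maximal ideal, `t` is the least degree with `Ext k R t ≠ 0` and
`M` has projective dimension exactly `n`, then `n ≤ t` and `Ext k M (t - n) ≠ 0`. -/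
theorem exists_nontrivial_ext_of_projectiveDimension {R : Type u} [CommRing R] [IsLocalRing R]
    [IsNoetherianRing R] {k : ModuleCat.{u} R} (hk : ∀ a ∈ maximalIdeal R, a • 𝟙 k = 0) {t : ℕ}
    (ht : ∀ j < t, Subsingleton (Abelian.Ext k (ModuleCat.of R R) j))
    (h : Nontrivial (Abelian.Ext k (ModuleCat.of R R) t)) (n : ℕ) (M : ModuleCat.{u} R)
    [Module.Finite R M] (hM : HasProjectiveDimensionLE M n) (hM' : ¬ HasProjectiveDimensionLT M n) :
    ∃ j, j + n = t ∧ Nontrivial (Abelian.Ext k M j) := by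
  induction n generalizing M with
  | zero =>
    rw [← projective_iff_hasProjectiveDimensionLE_zero, ← IsProjective.iff_projective] at hM
    rw [hasProjectiveDimensionLT_zero_iff_isZero, ModuleCat.isZero_iff_subsingleton,
      not_subsingleton_iff_nontrivial] at hM'
    have : Module.Free R M := Module.free_of_flat_of_isLocalRing
    exact ⟨t, rfl, nontrivial_ext_of_free h M⟩
  | succ n ih =>
    obtain ⟨r, f, hf, hmin⟩ := IsLocalRing.exists_minimal_cover (R := R) M
    let S : ShortComplex (ModuleCat.{u} R) := f.shortComplexKer
    have hS : S.ShortExact := LinearMap.shortExact_shortComplexKer hf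
    have hfin : Module.Finite R S.X₁ := inferInstanceAs (Module.Finite R (LinearMap.ker f))
    have hfree : Module.Free R S.X₂ := inferInstanceAs (Module.Free R (Fin r → R))
    have hproj : Projective S.X₂ := inferInstance
    have hK : HasProjectiveDimensionLE S.X₁ n := (hS.hasProjectiveDimensionLT_X₃_iff n hproj).mp hM
    have hK' : ¬ HasProjectiveDimensionLT S.X₁ n := fun h0 ↦
      hM' (hS.hasProjectiveDimensionLT_X₃ n h0 inferInstance)
    obtain ⟨j, hj, hnt⟩ := ih S.X₁ hK hK'
    obtain ⟨e, he⟩ := exists_ne (0 : Abelian.Ext k S.X₁ j)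
    have hzero : e.comp (Abelian.Ext.mk₀ S.f) (add_zero j) = 0 := by
      cases n with
      | zero =>
        rw [← projective_iff_hasProjectiveDimensionLE_zero, ← IsProjective.iff_projective] at hK
        have : Module.Free R S.X₁ := Module.free_of_flat_of_isLocalRing
        exact ext_comp_eq_zero (K := ModuleCat.of R (LinearMap.ker f)) hk (LinearMap.ker f).subtype
          (fun x i ↦ hmin x.1 x.2 i) e
      | succ n =>
        exact (subsingleton_ext_pi (ht j (by omega)) r).elim _ _
    obtain _ | j := j
    · exact absurd (Abelian.Ext.postcomp_mk₀_injective_of_mono k S.f (hf := hS.mono_f)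
        (by simpa using hzero)) he
    · obtain ⟨x, hx⟩ := Abelian.Ext.covariant_sequence_exact₁ k hS e hzero rfl
      refine ⟨j, by omega, x, 0, ?_⟩
      rintro rfl
      exact he (by rw [← hx, Abelian.Ext.zero_comp])

/-- A finite module of finite projective dimension over a Noetherian local ring has projective
dimension at most the Krull dimension of the ring. -/
theorem hasProjectiveDimensionLE_of_ringKrullDim_le {R : Type u} [CommRing R] [IsLocalRing R]
    [IsNoetherianRing R] (M : ModuleCat.{u} R) [Module.Finite R M] {n : ℕ}
    (hM : HasProjectiveDimensionLE M n) {d : ℕ} (hd : ringKrullDim R ≤ d) :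
    HasProjectiveDimensionLE M d := by
  classical
  let k := ModuleCat.of R (Shrink.{u} (R ⧸ maximalIdeal R))
  have hk : ∀ a ∈ maximalIdeal R, a • 𝟙 k = 0 := by
    intro a ha
    have hsmul (y : Shrink.{u} (R ⧸ maximalIdeal R)) : a • y = 0 := by
      apply (Shrink.linearEquiv R (R ⧸ maximalIdeal R)).injective
      obtain ⟨z, hz⟩ := Ideal.Quotient.mk_surjective (Shrink.linearEquiv R (R ⧸ maximalIdeal R) y)
      rw [map_smul, map_zero, ← hz, Algebra.smul_def, Ideal.Quotient.algebraMap_eq, ← map_mul]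
      exact Ideal.Quotient.eq_zero_iff_mem.mpr (Ideal.mul_mem_right _ _ ha)
    exact ModuleCat.hom_ext (LinearMap.ext hsmul)
  have hex : ∃ t, t ≤ d ∧ Nontrivial (Abelian.Ext k (ModuleCat.of R R) t) := by
    by_contra! hcon
    have hlt : maximalIdeal R • (⊤ : Submodule R (ModuleCat.of R R)) < ⊤ := by
      rw [lt_top_iff_ne_top]
      change maximalIdeal R • (⊤ : Ideal R) ≠ ⊤
      simpa using Ideal.IsPrime.ne_top'
    obtain ⟨rs, hlen, hmem, hreg⟩ := ((ModuleCat.exists_isRegular_tfae (maximalIdeal R) (d + 1)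
      (ModuleCat.of R R) hlt).out 1 3).mp (fun i hi ↦ hcon i (by omega))
    have := ringKrullDim_add_length_eq_ringKrullDim_of_isRegular rs hreg
    rw [hlen] at this
    have hle : (0 : WithBot ℕ∞) ≤ ringKrullDim (R ⧸ Ideal.ofList rs) := by
      have : Nontrivial (R ⧸ Ideal.ofList rs) := by
        rw [Ideal.Quotient.nontrivial_iff]
        intro h
        exact hreg.top_ne_smul (by rw [h]; simp)
      exact ringKrullDim_nonneg_of_nontrivial
    have h1 : ((d + 1 : ℕ) : WithBot ℕ∞) ≤ d :=
      calc ((d + 1 : ℕ) : WithBot ℕ∞) = 0 + (d + 1 : ℕ) := by simp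
        _ ≤ ringKrullDim (R ⧸ Ideal.ofList rs) + (d + 1 : ℕ) := by gcongr
        _ ≤ d := this.trans_le hd
    have h2 : d + 1 ≤ d := by exact_mod_cast h1
    omega
  have hspec := Nat.find_spec hex
  have hmin := fun j (hj : j < Nat.find hex) ↦ Nat.find_min hex hj
  by_contra hMd
  have hex2 : ∃ n, HasProjectiveDimensionLE M n := ⟨n, hM⟩
  have hge : d < Nat.find hex2 := by
    by_contra! hle
    have := Nat.find_spec hex2
    exact hMd (hasProjectiveDimensionLT_of_ge M (Nat.find hex2 + 1) (d + 1) (by omega))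
  have hm : ¬ HasProjectiveDimensionLT M (Nat.find hex2) := by
    obtain ⟨m, hm⟩ : ∃ m, Nat.find hex2 = m + 1 := Nat.exists_eq_succ_of_ne_zero (by omega)
    have := Nat.find_min hex2 (m := m) (by omega)
    rwa [hm]
  obtain ⟨j, hj, -⟩ := exists_nontrivial_ext_of_projectiveDimension hk (t := Nat.find hex)
    (fun j hj ↦ by
      have := hmin j hj
      rw [not_and, not_nontrivial_iff_subsingleton] at this
      exact this (by omega)) hspec.2 _ M (Nat.find_spec hex2) hm
  omega

/-- A scalar annihilating the derived-category `Ext` in positive degree annihilates `extMod`. -/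
theorem smul_extMod_eq_zero {R : Type u} [CommRing R] {M N : ModuleCat.{u} R} {i : ℕ} {s : R}
    (h : ∀ e : Abelian.Ext M N (i + 1), s • e = 0) (x : extMod R (i + 1) M N) : s • x = 0 := by
  let P := projectiveResolution M
  let C := P.complex.linearYonedaObj R N
  let φ : extMod R (i + 1) M N ≅ C.homology (i + 1) := P.isoExt (i + 1) N
  have hφ : Function.Injective φ.hom := (ModuleCat.mono_iff_injective φ.hom).1 inferInstance
  apply hφ
  rw [map_smul, map_zero]
  obtain ⟨z, hz⟩ := (ModuleCat.epi_iff_surjective (C.homologyπ (i + 1))).1 inferInstance (φ.hom x)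
  rw [← hz, ← map_smul]
  let f : P.complex.X (i + 1) ⟶ N := C.iCycles (i + 1) z
  have hf : P.complex.d (i + 2) (i + 1) ≫ f = 0 := by
    change C.d (i + 1) (i + 2) (C.iCycles (i + 1) z) = 0
    simp [← ModuleCat.comp_apply]
  have := P.extMk_comp_mk₀ f (i + 2) rfl hf (s • 𝟙 N)
  rw [← Abelian.Ext.smul_eq_comp_mk₀, h] at this
  obtain ⟨g, hg⟩ := (P.extMk_eq_zero_iff _ _ _ _ i rfl).1 this.symm
  let g' : C.X i := g
  have hz' : s • z = C.toCycles i (i + 1) g' := by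
    apply (ModuleCat.mono_iff_injective (C.iCycles (i + 1))).1 inferInstance
    rw [← ModuleCat.comp_apply, C.toCycles_i, map_smul]
    refine Eq.trans ?_ hg.symm
    rw [Linear.comp_smul, Category.comp_id]
    rfl
  rw [hz', ← ModuleCat.comp_apply, C.toCycles_comp_homologyπ]
  rfl

theorem subsingleton_ext_of_extMod {R : Type u} [CommRing R] {M N : ModuleCat.{u} R} {i : ℕ}
    (h : Subsingleton (extMod R (i + 1) M N)) : Subsingleton (Abelian.Ext M N (i + 1)) := by
  let P := projectiveResolution M
  let C := P.complex.linearYonedaObj R N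
  let φ : extMod R (i + 1) M N ≅ C.homology (i + 1) := P.isoExt (i + 1) N
  have hz : Limits.IsZero (C.homology (i + 1)) :=
    (ModuleCat.isZero_iff_subsingleton.2 h).of_iso φ.symm
  rw [← HomologicalComplex.exactAt_iff_isZero_homology,
    HomologicalComplex.exactAt_iff' C i (i + 1) (i + 2) (by simp) (by simp),
    ShortComplex.moduleCat_exact_iff] at hz
  refine subsingleton_of_forall_eq 0 fun e ↦ ?_
  obtain ⟨f, hf, rfl⟩ := P.extMk_surjective e (i + 2) rfl
  exact (P.extMk_eq_zero_iff _ _ _ _ i rfl).2 (hz f hf)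

theorem hasProjectiveDimensionLE_of_projDimLE {R : Type u} [CommRing R] {M : ModuleCat.{u} R}
    {n : ℕ} (h : projDimLE R M n) : HasProjectiveDimensionLE M n :=
  hasProjectiveDimensionLT_of_enoughInjectives M (n+1) fun N ↦ subsingleton_ext_of_extMod (h N)

/-- If the localization of a finite module `M` is projective, some scalar multiple of the identity
of `M` by a denominator factors through a projective module. -/
theorem exists_smul_id_factors_of_projective_localizedModule {R : Type u} [CommRing R]
    [IsNoetherianRing R] (S : Submonoid R) (M : ModuleCat.{u} R) [Module.Finite R M]
    (h : Projective (M.localizedModule S)) :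
    ∃ s ∈ S, ∃ (F : ModuleCat.{u} R) (_ : Projective F) (a : M →ₗ[R] F) (b : F →ₗ[R] M),
      b ∘ₗ a = s • LinearMap.id := by
  obtain ⟨F, hF, π, hπ⟩ : ∃ (F : ModuleCat.{u} R) (_ : Projective F) (π : F →ₗ[R] M),
      Function.Surjective π := by
    obtain ⟨n, π, hπ⟩ := Module.Finite.exists_fin' R M
    exact ⟨ModuleCat.of R (Fin n → R), (IsProjective.iff_projective _).1 inferInstance, π, hπ⟩
  have hM : Module.Projective (Localization S) (M.localizedModule S) :=
    (IsProjective.iff_projective _).2 h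
  have : Module.FinitePresentation R M := Module.finitePresentation_of_finite R M
  let mM := M.localizedModuleMkLinearMap S
  let mF := F.localizedModuleMkLinearMap S
  let πS := IsLocalizedModule.mapExtendScalars S mF mM (Localization S) π
  have hπS : Function.Surjective πS := IsLocalizedModule.map_surjective S mF mM π hπ
  obtain ⟨σ, hσ⟩ := Module.projective_lifting_property πS LinearMap.id hπS
  obtain ⟨a, s, ha⟩ := Module.FinitePresentation.exists_lift_of_isLocalizedModule S mF
    ((σ.restrictScalars R) ∘ₗ mM)
  have hcomp : mM ∘ₗ (π ∘ₗ a) = mM ∘ₗ ((s : R) • LinearMap.id) := by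
    ext x
    have h1 : mF (a x) = (s : R) • σ (mM x) := LinearMap.congr_fun ha x
    have h2 : πS (mF (a x)) = mM (π (a x)) := IsLocalizedModule.map_apply S mF mM π (a x)
    have h3 : πS (σ (mM x)) = mM x := LinearMap.congr_fun hσ (mM x)
    simp only [LinearMap.comp_apply, LinearMap.smul_apply, LinearMap.id_apply, map_smul]
    rw [← h2, h1, LinearMap.map_smul_of_tower, h3]
  obtain ⟨t, ht⟩ := Module.Finite.exists_smul_of_comp_eq_of_isLocalizedModule S mM _ _ hcomp
  refine ⟨t * s, (t * s).2, F, hF, a, (t : R) • π, ?_⟩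
  rw [mul_smul]
  exact ht

/-- If the localization of `M` at `S` has projective dimension at most `d`, then in each degree
`i > d` some `s ∈ S` annihilates `Ext M N i` for all `N`. -/
theorem exists_smul_ext_eq_zero_of_hasProjectiveDimensionLE_localizedModule {R : Type u}
    [CommRing R] [IsNoetherianRing R] (S : Submonoid R) {d : ℕ} (M : ModuleCat.{u} R)
    [Module.Finite R M] (h : HasProjectiveDimensionLE (M.localizedModule S) d) {i : ℕ}
    (hi : d < i) :
    ∃ s ∈ S, ∀ (N : ModuleCat.{u} R) (e : Abelian.Ext M N i), s • e = 0 := by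
  induction d generalizing M i with
  | zero =>
    rw [← projective_iff_hasProjectiveDimensionLE_zero] at h
    obtain ⟨s, hs, F, _, a, b, hab⟩ := exists_smul_id_factors_of_projective_localizedModule S M h
    refine ⟨s, hs, fun N e ↦ ?_⟩
    obtain ⟨j, rfl⟩ := Nat.exists_eq_succ_of_ne_zero hi.ne'
    have hid : s • 𝟙 M = ModuleCat.ofHom a ≫ ModuleCat.ofHom b := by
      rw [← ModuleCat.ofHom_comp, hab]
      rfl
    rw [← e.mk₀_id_comp, ← Abelian.Ext.smul_comp, ← Abelian.Ext.mk₀_smul, hid,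
      ← Abelian.Ext.mk₀_comp_mk₀, Abelian.Ext.comp_assoc_of_second_deg_zero,
      Abelian.Ext.eq_zero_of_projective ((Abelian.Ext.mk₀ (ModuleCat.ofHom b)).comp e _),
      Abelian.Ext.comp_zero]
  | succ d ih =>
    obtain ⟨r, f, hf⟩ := Module.Finite.exists_fin' R M
    let T : ShortComplex (ModuleCat.{u} R) := f.shortComplexKer
    have hT : T.ShortExact := LinearMap.shortExact_shortComplexKer hf
    have hfin : Module.Finite R T.X₁ := inferInstanceAs (Module.Finite R (LinearMap.ker f))
    have hfree : Module.Free R T.X₂ := inferInstanceAs (Module.Free R (Fin r → R))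
    have hproj : Projective T.X₂ := inferInstance
    have hTS := hT.map_of_exact (ModuleCat.localizedModuleFunctor S)
    have hK : HasProjectiveDimensionLE (T.X₁.localizedModule S) d :=
      (hTS.hasProjectiveDimensionLT_X₃_iff d
        ((ModuleCat.localizedModuleFunctor S).projective_obj _)).mp h
    obtain ⟨j, rfl⟩ := Nat.exists_eq_succ_of_ne_zero (show i ≠ 0 by omega)
    obtain ⟨s, hs, hkill⟩ := ih T.X₁ hK (i := j) (by omega)
    refine ⟨s, hs, fun N e ↦ ?_⟩
    obtain ⟨x, rfl⟩ := Abelian.Ext.contravariant_sequence_exact₃ hT N e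
      (Abelian.Ext.eq_zero_of_projective _) (show 1 + j = j + 1 by omega)
    rw [← Abelian.Ext.comp_smul, hkill, Abelian.Ext.comp_zero]
theorem Order.krullDim_add_le_of_le_height {α : Type*} [Preorder α] {s : Set α} {i : ℕ}
    (h : ∀ x ∈ s, (i : ℕ∞) ≤ Order.height x) :
    Order.krullDim s + (i : WithBot ℕ∞) ≤ Order.krullDim α := by
  have hsub : Order.krullDim s ≤ Order.krullDim α :=
    Order.krullDim_le_of_strictMono (Subtype.val : s → α) (Subtype.strictMono_coe _)
  induction hs : Order.krullDim s with
  | bot => simp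
  | coe m =>
    induction m with
    | top =>
      rw [hs] at hsub
      exact le_top.trans hsub
    | coe n =>
      obtain ⟨q, hq⟩ := Order.le_krullDim_iff.1 hs.ge
      let q' := q.map Subtype.val (Subtype.strictMono_coe _)
      obtain ⟨p, hp, hpl⟩ := Order.exists_series_of_le_height q'.head (h _ q.head.2)
      have := Order.LTSeries.length_le_krullDim (p.smash q' hp)
      refine le_trans (le_of_eq ?_) this
      simp [hpl, q', hq, add_comm]

/-- If `M` has finite projective dimension, primes in the support of `Ext^i(M, N)` have height at
least `i`. -/
theorem le_height_of_mem_support_extMod {R : Type u} [CommRing R] [IsNoetherianRing R]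
    {M N : ModuleCat.{u} R} [Module.Finite R M] {n : ℕ} (hM : HasProjectiveDimensionLE M n) {i : ℕ}
    {p : PrimeSpectrum R} (hp : p ∈ Module.support R (extMod R i M N)) :
    (i : ℕ∞) ≤ Order.height p := by
  obtain _ | j := i
  · simp
  by_contra! hlt
  have hle : Order.height p ≤ j := Order.le_of_lt_add_one (by exact_mod_cast hlt)
  let S := p.asIdeal.primeCompl
  have : IsLocalRing (Localization S) :=
    inferInstanceAs (IsLocalRing (Localization.AtPrime p.asIdeal))
  have hfin : Module.Finite (Localization S) (M.localizedModule S) :=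
    Module.Finite.of_isLocalizedModule S (M.localizedModuleMkLinearMap S)
  have hdim : ringKrullDim (Localization S) ≤ j := by
    refine (IsLocalization.AtPrime.ringKrullDim_eq_height p.asIdeal (Localization S)).trans_le ?_
    rw [PrimeSpectrum.height_eq_orderHeight]
    exact_mod_cast hle
  obtain ⟨s, hs, hkill⟩ := exists_smul_ext_eq_zero_of_hasProjectiveDimensionLE_localizedModule S M
    (hasProjectiveDimensionLE_of_ringKrullDim_le (M.localizedModule S)
      (ModuleCat.localizedModule_hasProjectiveDimensionLE n S M) hdim) j.lt_succ_self
  obtain ⟨x, hx⟩ := Module.mem_support_iff'.1 hp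
  exact hx s hs (smul_extMod_eq_zero (hkill N) x)

/-- Theorem 2.1(i), module case: if `M`, `N` are finitely generated over a commutative
Noetherian ring `R` and `M` has finite projective dimension, then
`dim_R Ext^i_R(M, N) + i ≤ dim R` for every `i`. -/
theorem dim_ext_add_le_of_finite_projDim (R : Type u) [CommRing R] [IsNoetherianRing R]
    (M N : ModuleCat.{u} R) [Module.Finite R M] [Module.Finite R N]
    (hpd : ∃ n : ℕ, projDimLE R M n) (i : ℕ) :
    supportDim R (extMod R i M N) + (i : WithBot ℕ∞) ≤ ringKrullDim R := by
  obtain ⟨n, hn⟩ := hpd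
  exact Order.krullDim_add_le_of_le_height fun _ hp ↦
    le_height_of_mem_support_extMod (hasProjectiveDimensionLE_of_projDimLE hn) hp
end

section
/- Let (R,m,k) be a commutative Noetherian local ring. Then R is Gorenstein if and only if for every finitely generated R-module M the supremum over i ∈ ℕ of (dim_R Ext^i_R(M,R) + i) is not +∞ (equivalently, for every finitely generated R-module M there is an n with Ext^i_R(M,R) = 0 for all i > n). (Corollary 2.3, equivalence of (i) and (iii).) -/
/-!
Common definitions: Ext modules, dimension of a module (Krull dimension of its
support, in `WithBot ℕ∞`, with `⊥` for the zero module), projective/injective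
dimension via the Ext-vanishing characterization, and cohomological dimension
with respect to an ideal via local cohomology.
-/

open CategoryTheory TensorProduct

universe u

/-- The depth of a Noetherian local ring `R`: the least `i` with `Ext^i_R(k, R) ≠ 0`,
where `k` is the residue field. -/
noncomputable def ringDepth (R : Type u) [CommRing R] [IsLocalRing R] : ℕ :=
  sInf {i : ℕ |
    ¬ Subsingleton (extMod R i (ModuleCat.of R (IsLocalRing.ResidueField R)) (ModuleCat.of R R))}

/-- A local ring is Gorenstein if `R` has finite injective dimension as a module
over itself. -/
def IsGorensteinLocalRing (R : Type u) [CommRing R] [IsLocalRing R] : Prop :=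
  ∃ n : ℕ, injDimLE R (ModuleCat.of R R) n

/-- A local ring is Cohen–Macaulay if its depth equals its Krull dimension. -/
def IsCohenMacaulayLocalRing (R : Type u) [CommRing R] [IsLocalRing R] : Prop :=
  ringKrullDim R = (ringDepth R : WithBot ℕ∞)

open Abelian in
theorem subsingleton_extMod_succ_iff {R : Type u} [CommRing R] (M N : ModuleCat.{u} R) (n : ℕ) :
    Subsingleton (extMod R (n + 1) M N) ↔ Subsingleton (Abelian.Ext.{u} M N (n + 1)) := by
  let P := projectiveResolution M
  have h₁ : Subsingleton (extMod R (n + 1) M N) ↔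
      ∀ f : P.complex.X (n + 1) ⟶ N, P.complex.d (n + 2) (n + 1) ≫ f = 0 →
        ∃ g : P.complex.X n ⟶ N, P.complex.d (n + 1) n ≫ g = f := by
    rw [← ModuleCat.isZero_iff_subsingleton, extMod, (P.isoExt (n + 1) N).isZero_iff,
      ← HomologicalComplex.exactAt_iff_isZero_homology,
      HomologicalComplex.exactAt_iff' _ n (n + 1) (n + 2) (by simp) (by simp),
      ShortComplex.moduleCat_exact_iff]
    rfl
  rw [h₁]
  constructor
  · intro h
    refine subsingleton_of_forall_eq 0 fun α ↦ ?_
    obtain ⟨f, hf, rfl⟩ := P.extMk_surjective α (n + 2) rfl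
    exact (P.extMk_eq_zero_iff f (n + 2) rfl hf n rfl).2 (h f hf)
  · intro h f hf
    exact (P.extMk_eq_zero_iff f (n + 2) rfl hf n rfl).1 (Subsingleton.elim _ _)

open Abelian in
theorem CategoryTheory.ShortComplex.ShortExact.subsingleton_ext_X₂ {C : Type*} [Category* C]
    [Abelian C] [HasExt C] {S : ShortComplex C} (hS : S.ShortExact) {Y : C} {n : ℕ}
    (h₁ : Subsingleton (Abelian.Ext S.X₁ Y n))
    (h₃ : Subsingleton (Abelian.Ext S.X₃ Y n)) : Subsingleton (Abelian.Ext S.X₂ Y n) := by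
  refine subsingleton_of_forall_eq 0 fun x ↦ ?_
  obtain ⟨y, rfl⟩ := Abelian.Ext.contravariant_sequence_exact₂ hS Y x (Subsingleton.elim _ _)
  simp [Subsingleton.elim y 0]

open Abelian in
theorem CategoryTheory.Abelian.Ext.subsingleton_of_iso_left {C : Type*} [Category* C]
    [Abelian C] [HasExt C] {X X' : C} (e : X ≅ X') {Y : C} {n : ℕ}
    (h : Subsingleton (Abelian.Ext X' Y n)) : Subsingleton (Abelian.Ext X Y n) := by
  refine subsingleton_of_forall_eq 0 fun x ↦ ?_
  rw [← Abelian.Ext.mk₀_id_comp x, ← e.hom_inv_id, ← Abelian.Ext.mk₀_comp_mk₀_assoc,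
    Subsingleton.elim ((Abelian.Ext.mk₀ e.inv).comp x (zero_add n)) 0, Abelian.Ext.comp_zero]

namespace ModuleCat

open Abelian

variable {R : Type u} [CommRing R]

theorem baer_of_subsingleton_ext_one {N : ModuleCat.{u} R}
    (h : ∀ I : Ideal R, Subsingleton (Abelian.Ext.{u} (ModuleCat.of R (R ⧸ I)) N 1)) :
    Module.Baer R N := by
  intro I g
  let S : ShortComplex (ModuleCat.{u} R) := ModuleCat.shortComplexOfCompEqZero I.subtype I.mkQ
    (by ext x; simpa using Ideal.Quotient.eq_zero_iff_mem.2 x.2)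
  have hS : S.ShortExact := ModuleCat.shortComplex_shortExact S
    (LinearMap.exact_subtype_mkQ I) (Submodule.subtype_injective I) (Submodule.mkQ_surjective I)
  have : Subsingleton (Abelian.Ext.{u} S.X₃ N 1) := h I
  obtain ⟨x, hx⟩ := Abelian.Ext.contravariant_sequence_exact₁ hS N
    (Abelian.Ext.mk₀ (ModuleCat.ofHom g)) (add_zero 1) (Subsingleton.elim _ _)
  obtain ⟨f, rfl⟩ := Abelian.Ext.homEquiv₀.symm.surjective x
  have hf : S.f ≫ f = ModuleCat.ofHom g := by
    apply Abelian.Ext.homEquiv₀.symm.injective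
    simpa using hx
  exact ⟨f.hom, fun y hy ↦ LinearMap.congr_fun (ModuleCat.hom_ext_iff.1 hf) ⟨y, hy⟩⟩

theorem hasInjectiveDimensionLE_of_subsingleton_ext_quotient {N : ModuleCat.{u} R} {n : ℕ}
    (h : ∀ I : Ideal R, Subsingleton (Abelian.Ext.{u} (ModuleCat.of R (R ⧸ I)) N (n + 1))) :
    HasInjectiveDimensionLE N n := by
  induction n generalizing N with
  | zero =>
    have := (baer_of_subsingleton_ext_one h).injective
    rw [HasInjectiveDimensionLE, ← injective_iff_hasInjectiveDimensionLT_one]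
    exact Module.injective_object_of_injective_module R N
  | succ n ih =>
    obtain ⟨J, _, f, _⟩ := EnoughInjectives.presentation N
    have hS : (ShortComplex.mk f (Limits.cokernel.π f) (Limits.cokernel.condition f)).ShortExact :=
      { exact := ShortComplex.exact_cokernel f }
    refine (hS.hasInjectiveDimensionLT_X₃_iff n ‹_›).1 (ih fun I ↦ ?_)
    refine subsingleton_of_forall_eq 0 fun x ↦ ?_
    have := h I
    obtain ⟨y, rfl⟩ := Abelian.Ext.covariant_sequence_exact₃ _ hS x rfl (Subsingleton.elim _ _)
    simp [y.eq_zero_of_injective]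

/-- Nakayama's lemma for the long exact sequence of multiplication by `x`. -/
theorem subsingleton_ext_of_smul_injective [IsNoetherianRing R] {M N : ModuleCat.{u} R}
    [Module.Finite R M] [Module.Finite R N] {x : R} (hx : x ∈ Ideal.jacobson (⊥ : Ideal R))
    (hM : IsSMulRegular M x) {n : ℕ}
    (h : Subsingleton (Abelian.Ext.{u} (ModuleCat.of R (QuotSMulTop x M)) N (n + 1))) :
    Subsingleton (Abelian.Ext.{u} M N n) := by
  by_contra! ntr
  have hx' : x ∈ (Module.annihilator R (Abelian.Ext.{u} M N n)).jacobson :=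
    Ideal.jacobson_mono bot_le hx
  refine Submodule.top_ne_pointwise_smul_of_mem_jacobson_annihilator hx'
    (top_le_iff.1 fun y _ ↦ ?_).symm
  obtain ⟨z, rfl⟩ := Abelian.Ext.contravariant_sequence_exact₁ hM.smulShortComplex_shortExact N y
    (add_comm 1 n) (h.elim _ _)
  have hz (z : Abelian.Ext.{u} M N n) :
      (Abelian.Ext.mk₀ (x • 𝟙 M)).comp z (zero_add n) = x • z := by
    simp [Abelian.Ext.mk₀_smul, Abelian.Ext.smul_comp]
  have hmem := Submodule.smul_mem_pointwise_smul (R := R) (show Abelian.Ext.{u} M N n from z) x ⊤ trivial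
  rw [← hz] at hmem
  exact hmem

open IsLocalRing in
theorem subsingleton_ext_of_residueField [IsNoetherianRing R] [IsLocalRing R] {N : ModuleCat.{u} R}
    [Module.Finite R N] {n : ℕ}
    (h : ∀ i > n, Subsingleton (Abelian.Ext.{u} (ModuleCat.of R (ResidueField R)) N i))
    (M : ModuleCat.{u} R) [Module.Finite R M] {i : ℕ} (hi : n < i) :
    Subsingleton (Abelian.Ext.{u} M N i) := by
  suffices ∀ (I : Ideal R) (M : Type u) [AddCommGroup M] [Module R M] [Module.Finite R M],
      I ≤ Module.annihilator R M → ∀ i > n, Subsingleton (Abelian.Ext.{u} (ModuleCat.of R M) N i) from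
    this ⊥ M bot_le i hi
  clear! M
  intro I
  induction I using WellFoundedGT.induction with
  | ind I ih =>
  intro M _ _ _
  induction ‹Module.Finite R M› using
    IsNoetherianRing.induction_on_isQuotientEquivQuotientPrime R with
  | subsingleton M =>
    intro _ i _
    exact subsingleton_of_forall_eq 0 fun x ↦ by
      rw [← Abelian.Ext.mk₀_id_comp x,
        (ModuleCat.isZero_of_subsingleton (ModuleCat.of R M)).eq_of_src (𝟙 _) 0]
      simp
  | quotient M p e =>
    intro hI i hi
    rw [e.annihilator_eq, Ideal.annihilator_quotient] at hI
    obtain hI | rfl := hI.lt_or_eq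
    · exact ih _ hI M (by rw [e.annihilator_eq, Ideal.annihilator_quotient]) i hi
    have := p.2
    by_cases hm : p.1 = maximalIdeal R
    · let e' : M ≃ₗ[R] ResidueField R := e ≪≫ₗ Submodule.quotEquivOfEq _ _ hm
      have := h i hi
      exact Abelian.Ext.subsingleton_of_iso_left (LinearEquiv.toModuleIso e') this
    obtain ⟨x, hx, hxp⟩ := SetLike.exists_of_lt ((le_maximalIdeal p.2.ne_top).lt_of_ne hm)
    have hreg : IsSMulRegular M x := by
      rw [e.isSMulRegular_congr]
      refine isSMulRegular_iff_right_eq_zero_of_smul.2 fun y hy ↦ ?_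
      obtain ⟨y, rfl⟩ := Ideal.Quotient.mk_surjective y
      rw [Algebra.smul_def, Ideal.Quotient.algebraMap_eq, ← map_mul,
        Ideal.Quotient.eq_zero_iff_mem] at hy
      exact Ideal.Quotient.eq_zero_iff_mem.2 ((p.2.mem_or_mem hy).resolve_left hxp)
    refine subsingleton_ext_of_smul_injective (M := ModuleCat.of R M)
      (maximalIdeal_le_jacobson _ hx) hreg ?_
    have hann : p.1 ⊔ Ideal.span {x} ≤ Module.annihilator R (QuotSMulTop x M) := by
      refine sup_le ?_ ?_
      · rw [← Ideal.annihilator_quotient (I := p.1), ← e.annihilator_eq]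
        exact LinearMap.annihilator_le_of_surjective (Submodule.mkQ _) (Submodule.mkQ_surjective _)
      · exact (Ideal.span_singleton_le_iff_mem _).2 (QuotSMulTop.mem_annihilator M x)
    refine ih _ ?_ (QuotSMulTop x M) hann (i + 1) (by lia)
    exact left_lt_sup.2 (by simpa [Ideal.span_singleton_le_iff_mem] using hxp)
  | exact M₁ M₂ M₃ f g hf hg hfg h₁ h₃ =>
    intro hI i hi
    exact (ModuleCat.shortComplex_shortExact (ModuleCat.shortComplexOfCompEqZero f g
      hfg.linearMap_comp_eq_zero) hfg hf hg).subsingleton_ext_X₂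
        (h₁ (hI.trans (f.annihilator_le_of_injective hf)) i hi)
        (h₃ (hI.trans (g.annihilator_le_of_surjective hg)) i hi)

end ModuleCat

theorem supportDim_le_ringKrullDim (R : Type u) [CommRing R] (M : Type u) [AddCommGroup M]
    [Module R M] : supportDim R M ≤ ringKrullDim R :=
  Order.krullDim_le_of_strictMono (fun p ↦ p.1) fun _ _ h ↦ h

theorem supportDim_of_subsingleton (R : Type u) [CommRing R] (M : Type u) [AddCommGroup M]
    [Module R M] [Subsingleton M] : supportDim R M = ⊥ :=
  Module.supportDim_eq_bot_of_subsingleton R M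

theorem supportDim_nonneg (R : Type u) [CommRing R] (M : Type u) [AddCommGroup M]
    [Module R M] [Nontrivial M] : 0 ≤ supportDim R M := by
  have : Nonempty (Module.support R M) := (Module.nonempty_support_of_nontrivial).to_subtype
  exact Order.krullDim_nonneg

theorem iSup_supportDim_add_ne_top_iff {R : Type u} [CommRing R] [FiniteRingKrullDim R]
    (E : ℕ → ModuleCat.{u} R) :
    (⨆ i : ℕ, (supportDim R (E i) + (i : WithBot ℕ∞))) ≠ ⊤ ↔
      ∃ n, ∀ i > n, Subsingleton (E i) := by
  constructor
  · intro h
    contrapose! h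
    refine ENat.WithBot.eq_top_iff_forall_ge.2 fun n ↦ ?_
    obtain ⟨i, hi, hE⟩ := h n
    calc (n : WithBot ℕ∞) ≤ 0 + i := by rw [zero_add]; exact_mod_cast hi.le
      _ ≤ supportDim R (E i) + i := by gcongr; exact supportDim_nonneg R _
      _ ≤ _ := le_iSup (fun i ↦ supportDim R (E i) + (i : WithBot ℕ∞)) i
  · rintro ⟨n, hn⟩
    refine ne_top_of_le_ne_top (b := ringKrullDim R + n) ?_ (iSup_le fun i ↦ ?_)
    · have hd : ringKrullDim R ≠ ⊤ := ringKrullDim_ne_top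
      generalize ringKrullDim R = d at hd
      obtain _ | _ | d := d
      · exact WithBot.bot_ne_coe
      · exact absurd rfl hd
      · exact fun h ↦ ENat.natCast_ne_top (d + n) (WithBot.coe_injective h)
    obtain hi | hi := le_or_gt i n
    · gcongr
      exact supportDim_le_ringKrullDim R _
    · have := hn i hi
      simp [supportDim_of_subsingleton]

/-- Corollary 2.3, (i) ⇔ (iii): a commutative Noetherian local ring `R` is Gorenstein
iff for every finitely generated `R`-module `M` the supremum over `i` of
`dim_R Ext^i_R(M, R) + i` is not `+∞`. -/
theorem isGorensteinLocalRing_iff_forall_dim_rhom_ne_top (R : Type u) [CommRing R]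
    [IsNoetherianRing R] [IsLocalRing R] :
    IsGorensteinLocalRing R ↔
      ∀ (M : ModuleCat.{u} R), Module.Finite R M →
        (⨆ i : ℕ, (supportDim R (extMod R i M (ModuleCat.of R R)) + (i : WithBot ℕ∞))) ≠ ⊤ := by
  simp only [iSup_supportDim_add_ne_top_iff]
  constructor
  · rintro ⟨n, hn⟩ M -
    have := hasInjectiveDimensionLT_of_enoughProjectives (ModuleCat.of R R) (n + 1)
      fun M ↦ (subsingleton_extMod_succ_iff M _ n).1 (hn M)
    refine ⟨n, fun i hi ↦ ?_⟩
    obtain ⟨i, rfl⟩ := Nat.exists_eq_add_of_lt hi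
    exact (subsingleton_extMod_succ_iff M _ _).2
      (HasInjectiveDimensionLT.subsingleton _ (n + 1) _ (by lia) M)
  · intro h
    obtain ⟨n, hn⟩ := h (ModuleCat.of R (IsLocalRing.ResidueField R)) inferInstance
    have hext (M : ModuleCat.{u} R) [Module.Finite R M] :
        Subsingleton (Abelian.Ext.{u} M (ModuleCat.of R R) (n + 1)) :=
      ModuleCat.subsingleton_ext_of_residueField (n := n) (fun i hi ↦ by
        obtain ⟨i, rfl⟩ := Nat.exists_eq_add_of_lt hi
        exact (subsingleton_extMod_succ_iff _ _ _).1 (hn _ hi)) M n.lt_succ_self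
    have := ModuleCat.hasInjectiveDimensionLE_of_subsingleton_ext_quotient (n := n)
      (N := ModuleCat.of R R) fun I ↦ hext _
    exact ⟨n, fun M ↦ (subsingleton_extMod_succ_iff _ _ _).2
      (HasInjectiveDimensionLT.subsingleton _ (n + 1) _ le_rfl M)⟩
end

section
/- Let R be a commutative Noetherian ring, let M be a finitely generated R-module of finite projective dimension, and let N be an arbitrary R-module. Then for every integer i ≥ 0, dim_R Ext^i_R(M,N) + i ≤ dim_R N + proj.dim_R M. (Module case of Theorem 2.6(i): dim RHom_R(X,Y) ≤ dim Y + proj.dim X.) -/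
/-!
Common definitions: Ext modules, dimension of a module (Krull dimension of its
support, in `WithBot ℕ∞`, with `⊥` for the zero module), projective/injective
dimension via the Ext-vanishing characterization, and cohomological dimension
with respect to an ideal via local cohomology.
-/

open CategoryTheory TensorProduct

universe u

open Abelian CochainComplex HomComplex in
/-- In degree zero, a cocycle on a projective resolution representing the zero class vanishes. -/
lemma CategoryTheory.ProjectiveResolution.extMk_eq_zero_iff_of_degree_zero
    {C : Type*} [Category* C] [Abelian C] [HasExt C] {X Y : C} (P : ProjectiveResolution X)
    (f : P.complex.X 0 ⟶ Y) (m : ℕ) (hm : 0 + 1 = m) (hf : P.complex.d m 0 ≫ f = 0) :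
    P.extMk f m hm hf = 0 ↔ f = 0 := by
  refine ⟨fun h ↦ ?_, ?_⟩
  · rw [← P.extEquivCohomologyClass.apply_eq_iff_eq, P.extEquivCohomologyClass_extMk,
      P.extEquivCohomologyClass_zero, CohomologyClass.mk_eq_zero_iff,
      Cocycle.toSingleMk_mem_coboundaries_iff _ _ _ _ _ 1 (by simp)] at h
    obtain ⟨g, hg⟩ := h
    have hg0 : g = 0 := (CochainComplex.isZero_of_isStrictlyLE P.cochainComplex 0 1).eq_of_src _ _
    rw [hg0, Limits.comp_zero] at hg
    rw [← cancel_epi (P.cochainComplexXIso (-(0 : ℕ)) 0 rfl).hom, Limits.comp_zero]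
    exact hg.symm
  · rintro rfl
    simp

lemma CategoryTheory.ProjectiveResolution.smul_extMk
    {R C : Type*} [CommRing R] [Category* C] [Abelian C] [Linear R C] [HasExt C] {X Y : C}
    (P : ProjectiveResolution X) {n : ℕ} (r : R) (f : P.complex.X n ⟶ Y) (m : ℕ)
    (hm : n + 1 = m) (hf : P.complex.d m n ≫ f = 0) :
    r • P.extMk f m hm hf = P.extMk (r • f) m hm (by simp [hf]) := by
  rw [Abelian.Ext.smul_eq_comp_mk₀, P.extMk_comp_mk₀]
  simp

/-- The class map from the cocycles of `Hom(P, N)` to `Ext`, for a projective resolution `P`. -/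
noncomputable def extClassMap {R : Type u} [CommRing R] {M : ModuleCat.{u} R}
    (P : ProjectiveResolution M) (N : ModuleCat.{u} R) (n : ℕ) :
    LinearMap.ker ((P.complex.linearYonedaObj R N).sc n).g.hom →ₗ[R] Abelian.Ext M N n where
  toFun f := P.extMk f.1 ((ComplexShape.up ℕ).next n) (by simp) f.2
  map_add' f g := (P.add_extMk _ _ _ _ _ _).symm
  map_smul' r f := (P.smul_extMk _ _ _ _ _).symm

lemma extClassMap_surjective {R : Type u} [CommRing R] {M : ModuleCat.{u} R}
    (P : ProjectiveResolution M) (N : ModuleCat.{u} R) (n : ℕ) :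
    Function.Surjective (extClassMap P N n) := by
  intro α
  obtain ⟨f, hf, h⟩ := P.extMk_surjective α ((ComplexShape.up ℕ).next n) (by simp)
  exact ⟨⟨f, hf⟩, h⟩

lemma ker_extClassMap {R : Type u} [CommRing R] {M : ModuleCat.{u} R}
    (P : ProjectiveResolution M) (N : ModuleCat.{u} R) (n : ℕ) :
    LinearMap.ker (extClassMap P N n) =
      LinearMap.range ((P.complex.linearYonedaObj R N).sc n).moduleCatToCycles := by
  ext ⟨f, hf⟩
  change P.complex.X n ⟶ N at f
  rw [LinearMap.mem_ker, LinearMap.mem_range]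
  change P.extMk f ((ComplexShape.up ℕ).next n) (by simp) hf = 0 ↔ _
  simp only [Subtype.ext_iff]
  change _ ↔ ∃ g, P.complex.d n ((ComplexShape.up ℕ).prev n) ≫ g = f
  cases n with
  | zero =>
    refine (P.extMk_eq_zero_iff_of_degree_zero _ _ _ hf).trans ?_
    simp [eq_comm]
  | succ n => exact P.extMk_eq_zero_iff _ _ _ hf _ (by simp)

/-- The derived functor `extMod` agrees with the `Ext` modules of the derived category. -/
lemma nonempty_extMod_linearEquiv {R : Type u} [CommRing R] (M N : ModuleCat.{u} R) (n : ℕ) :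
    Nonempty (extMod R n M N ≃ₗ[R] Abelian.Ext M N n) := by
  let P := projectiveResolution M
  exact ⟨((P.isoExt n N ≪≫
      ((P.complex.linearYonedaObj R N).sc n).moduleCatHomologyIso).toLinearEquiv.trans
    (Submodule.quotEquivOfEq _ _ (ker_extClassMap P N n).symm)).trans
    ((extClassMap P N n).quotKerEquivOfSurjective (extClassMap_surjective P N n))⟩

/-- If `Ext^{n+1}(M, -)` vanishes then so does `Ext^i(M, -)` for every `i > n`. -/
lemma projDimLE.subsingleton_ext {R : Type u} [CommRing R] {M : ModuleCat.{u} R} {n : ℕ}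
    (h : projDimLE R M n) {i : ℕ} (hi : n + 1 ≤ i) (N : ModuleCat.{u} R) :
    Subsingleton (Abelian.Ext M N i) := by
  induction i, hi using Nat.le_induction generalizing N with
  | base =>
    have := h N
    exact (nonempty_extMod_linearEquiv M N (n + 1)).some.symm.toEquiv.subsingleton
  | succ i hi ih =>
    have hS : (ShortComplex.mk (Injective.ι N) (Limits.cokernel.π (Injective.ι N))
        (by simp)).ShortExact :=
      { exact := ShortComplex.exact_cokernel _ }
    have := ih (Limits.cokernel (Injective.ι N))
    have : Injective (ShortComplex.mk (Injective.ι N) (Limits.cokernel.π (Injective.ι N))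
        (by simp)).X₂ := inferInstanceAs (Injective (Injective.under N))
    exact (postcomp_extClass_surjective_of_projective_X₂ hS M i).subsingleton

/-- For `M` finitely generated over a Noetherian ring, `Supp Ext^i(M, N) ⊆ Supp N`. -/
lemma support_ext_subset (R : Type u) [CommRing R] [IsNoetherianRing R]
    (M N : ModuleCat.{u} R) [Module.Finite R M] (i : ℕ) :
    Module.support R (Abelian.Ext M N i) ⊆ Module.support R N := by
  induction i generalizing M with
  | zero =>
    intro p hp
    rw [(Abelian.Ext.linearEquiv₀.trans ModuleCat.homLinearEquiv :
      Abelian.Ext M N 0 ≃ₗ[R] (M →ₗ[R] N)).support_eq] at hp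
    by_contra hN
    rw [Module.notMem_support_iff'] at hN
    obtain ⟨f, hf⟩ := Module.mem_support_iff'.mp hp
    obtain ⟨s, hs⟩ := Module.Finite.fg_top (R := R) (M := M)
    choose r hr hr0 using fun m ↦ hN (f m)
    refine hf (∏ m ∈ s, r m) (p.asIdeal.primeCompl.prod_mem fun m _ ↦ hr m) ?_
    refine LinearMap.ext_on hs fun m hm ↦ ?_
    obtain ⟨c, hc⟩ := Finset.dvd_prod_of_mem r hm
    simp [hc, mul_comm (r m), mul_smul, hr0]
  | succ i ih =>
    obtain ⟨F, _, _, _, _, f, hf⟩ := Module.exists_finite_presentation R M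
    let hS := LinearMap.shortExact_shortComplexKer hf
    exact (Module.support_subset_of_surjective (hS.extClass.precompOfLinear R N (add_comm 1 i))
      (precomp_extClass_surjective_of_projective_X₂ N hS i)).trans (ih _)

/-- Theorem 2.6(i), module case: if `M` is a finitely generated module of finite
projective dimension over a commutative Noetherian ring `R` and `N` is an arbitrary
`R`-module, then `dim_R Ext^i_R(M, N) + i ≤ dim_R N + proj.dim_R M` for every `i`. -/
theorem dim_ext_add_le_dim_add_projDim (R : Type u) [CommRing R] [IsNoetherianRing R]
    (M : ModuleCat.{u} R) [Module.Finite R M] (hpd : ∃ n : ℕ, projDimLE R M n)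
    (N : ModuleCat.{u} R) (i : ℕ) :
    supportDim R (extMod R i M N) + (i : WithBot ℕ∞) ≤ supportDim R N + projDim R M := by
  have e := (nonempty_extMod_linearEquiv M N i).some
  rcases subsingleton_or_nontrivial (extMod R i M N) with hE | hE
  · have h : supportDim R (extMod R i M N) = ⊥ := by
      rw [supportDim, Module.support_eq_empty]
      exact Order.krullDim_eq_bot
    simp [h]
  · refine add_le_add ?_ (le_sInf ?_)
    · have h : Module.support R (extMod R i M N) ⊆ Module.support R N :=
        e.support_eq.trans_subset (support_ext_subset R M N i)
      exact Order.krullDim_le_of_strictMono (Set.inclusion h) fun _ _ hab ↦ hab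
    · rintro _ ⟨n, rfl, hn⟩
      by_contra! hlt
      have hi : n + 1 ≤ i := by exact_mod_cast hlt
      have := hn.subsingleton_ext hi N
      exact not_subsingleton _ e.toEquiv.subsingleton
end

section
/- Let R be a commutative Noetherian ring of finite Krull dimension, let a be an ideal of R, and let M and N be finitely generated R-modules with M of finite projective dimension. Then for all integers i, j ≥ 0 with H^j_a(Ext^i_R(M,N)) ≠ 0, one has i + j ≤ cd(a,N) + proj.dim_R M; equivalently, sup over i of (cd(a, Ext^i_R(M,N)) + i) ≤ cd(a,N) + proj.dim_R M. (Module case of Theorem 3.2(i): -inf RΓ_a(RHom_R(X,Y)) ≤ -inf RΓ_a(Y) + proj.dim X.) -/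
/-!
Common definitions: Ext modules, dimension of a module (Krull dimension of its
support, in `WithBot ℕ∞`, with `⊥` for the zero module), projective/injective
dimension via the Ext-vanishing characterization, and cohomological dimension
with respect to an ideal via local cohomology.
-/

open CategoryTheory TensorProduct

universe u

section comparison

open Limits Abelian Opposite HomologicalComplex

variable {R : Type u} [CommRing R]

/-- The map `Hom(L, Y) ⟶ Hom(K, Y)` induced by a chain map `K ⟶ L`. -/
noncomputable def linearYonedaObjMap {K L : ChainComplex (ModuleCat.{u} R) ℕ} (φ : K ⟶ L)
    (Y : ModuleCat.{u} R) :
    L.linearYonedaObj R Y ⟶ K.linearYonedaObj R Y :=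
  (HomologicalComplex.unopFunctor _ _).map
    (((((linearYoneda R (ModuleCat.{u} R)).obj Y).rightOp.mapHomologicalComplex _).map φ)).op

lemma extMod_map_isoExt {X X' : ModuleCat.{u} R} (g : X' ⟶ X) (P : ProjectiveResolution X)
    (P' : ProjectiveResolution X') (φ : P'.Hom P g) (n : ℕ) (Y : ModuleCat.{u} R) :
    ((Ext R (ModuleCat.{u} R) n).map g.op).app Y ≫ (P'.isoExt n Y).hom =
    (P.isoExt n Y).hom ≫ homologyMap (linearYonedaObjMap φ.hom Y) n := by
  have h1 := ProjectiveResolution.isoLeftDerivedObj_inv_naturality g P' P φ.hom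
    φ.hom_f_zero_comp_π_f_zero ((linearYoneda R (ModuleCat.{u} R)).obj Y).rightOp n
  have h2 := homologyOp_hom_naturality (linearYonedaObjMap φ.hom Y) n
  have h3 := congrArg Quiver.Hom.unop h1
  have h4 := congrArg Quiver.Hom.unop h2
  have key : ∀ {A A' B B' C C' : ModuleCat.{u} R} (f : A ⟶ A') (i : A ⟶ B) (i' : A' ⟶ B')
    (m : B ⟶ B') (e : C ≅ B) (e' : C' ≅ B') (p : C ⟶ C'), f ≫ i' = i ≫ m → e.hom ≫ m = p ≫ e'.hom →
      f ≫ i' ≫ e'.inv = (i ≫ e.inv) ≫ p := by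
    intro A A' B B' C C' f i i' m e e' p h1 h2
    rw [← Category.assoc, h1, ← cancel_mono e'.hom]
    simp [← h2]
  exact key _ _ _ _ (HomologicalComplex.homologyUnop _ _)
    (HomologicalComplex.homologyUnop _ _) _ h3 h4

lemma d_iCycles_apply {ι : Type} {c : ComplexShape ι} (K : HomologicalComplex (ModuleCat.{u} R) c)
    (n m : ι) (z : K.cycles n) : K.d n m (K.iCycles n z) = 0 := by
  rw [← ConcreteCategory.comp_apply, iCycles_d]
  rfl

lemma exists_iCycles_eq {ι : Type} {c : ComplexShape ι} (K : HomologicalComplex (ModuleCat.{u} R) c)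
    (n m : ι) (h : c.next n = m) (x : K.X n) (hx : K.d n m x = 0) :
    ∃ z : K.cycles n, K.iCycles n z = x := by
  refine ⟨K.cyclesMk x m h hx, K.i_cyclesMk x m h hx⟩

lemma homologyπ_eq_zero_iff {ι : Type} {c : ComplexShape ι}
    (K : HomologicalComplex (ModuleCat.{u} R) c) (p n : ι) (h : c.prev n = p) (z : K.cycles n) :
    K.homologyπ n z = 0 ↔ ∃ y, K.d p n y = K.iCycles n z := by
  have hex : (ShortComplex.mk _ _ (K.toCycles_comp_homologyπ p n)).Exact :=
    ShortComplex.exact_of_g_is_cokernel _ (K.homologyIsCokernel p n h)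
  rw [ShortComplex.moduleCat_exact_iff] at hex
  have hi : ∀ y, K.iCycles n (K.toCycles p n y) = K.d p n y := fun y ↦ by
    rw [← ConcreteCategory.comp_apply, toCycles_i]
  constructor
  · intro hz
    obtain ⟨y, rfl⟩ := hex z hz
    exact ⟨y, (hi y).symm⟩
  · rintro ⟨y, hy⟩
    obtain rfl : K.toCycles p n y = z :=
      (ModuleCat.mono_iff_injective (K.iCycles n)).1 inferInstance ((hi y).trans hy)
    rw [← ConcreteCategory.comp_apply, toCycles_comp_homologyπ]
    rfl

lemma extMk_zero_eq_zero_iff {X Y : ModuleCat.{u} R} (P : ProjectiveResolution X)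
    (f : P.complex.X 0 ⟶ Y) (hf : P.complex.d 1 0 ≫ f = 0) :
    P.extMk f 1 rfl hf = 0 ↔ f = 0 := by
  simp only [← P.extEquivCohomologyClass.apply_eq_iff_eq,
    P.extEquivCohomologyClass_extMk, P.extEquivCohomologyClass_zero,
    CochainComplex.HomComplex.CohomologyClass.mk_eq_zero_iff]
  rw [CochainComplex.HomComplex.Cocycle.toSingleMk_mem_coboundaries_iff _ _ _ _ _ 1 (by simp)]
  have hz : IsZero (P.cochainComplex.X 1) :=
    CochainComplex.isZero_of_isStrictlyLE P.cochainComplex 0 1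
  constructor
  · rintro ⟨g, hg⟩
    rw [hz.eq_of_src g 0, comp_zero] at hg
    rw [← cancel_epi (P.cochainComplexXIso (-(0 : ℕ)) 0 rfl).hom, ← hg, comp_zero]
  · rintro rfl
    exact ⟨0, by simp⟩

lemma extMk_congr {X Y : ModuleCat.{u} R} (P : ProjectiveResolution X) {n : ℕ}
    {f g : P.complex.X n ⟶ Y} (hfg : f = g) (hf : P.complex.d (n + 1) n ≫ f = 0)
    (hg : P.complex.d (n + 1) n ≫ g = 0) :
    P.extMk f (n + 1) rfl hf = P.extMk g (n + 1) rfl hg := by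
  subst hfg
  rfl

/-- A cocycle of `Hom(P, Y)`, as a morphism `P_n ⟶ Y`. -/
noncomputable def cocycleHom {X : ModuleCat.{u} R} (P : ProjectiveResolution X) (n : ℕ)
    (Y : ModuleCat.{u} R) :
    (P.complex.linearYonedaObj R Y).cycles n →ₗ[R] (P.complex.X n ⟶ Y) :=
  ((P.complex.linearYonedaObj R Y).iCycles n).hom

lemma d_comp_cocycleHom {X : ModuleCat.{u} R} (P : ProjectiveResolution X) (n : ℕ)
    (Y : ModuleCat.{u} R) (z : (P.complex.linearYonedaObj R Y).cycles n) :
    P.complex.d (n + 1) n ≫ cocycleHom P n Y z = 0 :=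
  d_iCycles_apply (P.complex.linearYonedaObj R Y) n (n + 1) z

/-- The class in `Abelian.Ext X Y n` of an `n`-cocycle of `Hom(P, Y)`. -/
noncomputable def extOfCocycle {X : ModuleCat.{u} R} (P : ProjectiveResolution X) (n : ℕ)
    (Y : ModuleCat.{u} R) :
    (P.complex.linearYonedaObj R Y).cycles n →ₗ[R] Abelian.Ext X Y n where
  toFun z := P.extMk (cocycleHom P n Y z) (n + 1) rfl (d_comp_cocycleHom P n Y z)
  map_add' z w := by
    rw [P.add_extMk]
    exact extMk_congr P (map_add _ z w) _ _
  map_smul' r z := by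
    rw [RingHom.id_apply, Ext.smul_eq_comp_mk₀, P.extMk_comp_mk₀]
    refine extMk_congr P ((map_smul _ r z).trans ?_) _ _
    ext x
    rfl

lemma extOfCocycle_surjective {X : ModuleCat.{u} R} (P : ProjectiveResolution X) (n : ℕ)
    (Y : ModuleCat.{u} R) :
    Function.Surjective (extOfCocycle P n Y) := by
  intro α
  obtain ⟨f, hf, rfl⟩ := P.extMk_surjective α (n + 1) rfl
  obtain ⟨z, hz⟩ := exists_iCycles_eq (P.complex.linearYonedaObj R Y) n (n + 1)
    (ComplexShape.next_eq' _ rfl) f hf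
  exact ⟨z, extMk_congr P hz (d_comp_cocycleHom P n Y z) hf⟩

lemma extOfCocycle_eq_zero_iff {X : ModuleCat.{u} R} (P : ProjectiveResolution X) (n : ℕ)
    (Y : ModuleCat.{u} R) (z) :
    extOfCocycle P n Y z = 0 ↔ (P.complex.linearYonedaObj R Y).homologyπ n z = 0 := by
  rcases n with _ | n
  · rw [homologyπ_eq_zero_iff _ 0 0 (by simp)]
    refine (extMk_zero_eq_zero_iff P _ (d_comp_cocycleHom P 0 Y z)).trans
      ⟨fun h ↦ ⟨0, ?_⟩, fun ⟨y, hy⟩ ↦ ?_⟩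
    · rw [map_zero]
      exact h.symm
    · refine hy.symm.trans ?_
      rw [shape _ _ _ (by simp)]
      rfl
  · rw [homologyπ_eq_zero_iff _ n (n + 1) (ComplexShape.prev_eq' _ rfl)]
    exact P.extMk_eq_zero_iff _ _ rfl (d_comp_cocycleHom P (n + 1) Y z) n rfl

/-- `Abelian.Ext X Y n` is the `n`-th cohomology of `Hom(P, Y)`. -/
noncomputable def extEquivHomology {X : ModuleCat.{u} R} (P : ProjectiveResolution X) (n : ℕ)
    (Y : ModuleCat.{u} R) :
    Abelian.Ext X Y n ≃ₗ[R] (P.complex.linearYonedaObj R Y).homology n :=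
  ((extOfCocycle P n Y).quotKerEquivOfSurjective (extOfCocycle_surjective P n Y)).symm.trans
    ((Submodule.quotEquivOfEq _ _ (by ext z; exact extOfCocycle_eq_zero_iff P n Y z)).trans
     (((P.complex.linearYonedaObj R Y).homologyπ n).hom.quotKerEquivOfSurjective
       ((ModuleCat.epi_iff_surjective _).1 inferInstance)))

lemma extEquivHomology_extOfCocycle {X : ModuleCat.{u} R} (P : ProjectiveResolution X) (n : ℕ)
    (Y : ModuleCat.{u} R) (z) : extEquivHomology P n Y (extOfCocycle P n Y z) =
      (P.complex.linearYonedaObj R Y).homologyπ n z := by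
  have : ((extOfCocycle P n Y).quotKerEquivOfSurjective (extOfCocycle_surjective P n Y)).symm
     (extOfCocycle P n Y z) = Submodule.Quotient.mk z := by
    rw [LinearEquiv.symm_apply_eq]; rfl
  simp only [extEquivHomology, LinearEquiv.trans_apply, this]
  rfl

/-- Comparison of `Abelian.Ext` with the left derived functor of `Hom(-, Y)`. -/
noncomputable def extEquivExtMod {X : ModuleCat.{u} R} (P : ProjectiveResolution X) (n : ℕ)
    (Y : ModuleCat.{u} R) :
    Abelian.Ext X Y n ≃ₗ[R] extMod R n X Y :=
  (extEquivHomology P n Y).trans (P.isoExt n Y).symm.toLinearEquiv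

lemma extEquivExtMod_naturality {X X' : ModuleCat.{u} R} (g : X' ⟶ X) (P : ProjectiveResolution X)
    (P' : ProjectiveResolution X') (n : ℕ) (Y : ModuleCat.{u} R) (x : Abelian.Ext X Y n) :
    extEquivExtMod P' n Y ((Abelian.Ext.mk₀ g).comp x (zero_add n)) =
    ((Ext R (ModuleCat.{u} R) n).map g.op).app Y (extEquivExtMod P n Y x) := by
  let φ : P'.Hom P g := {
    hom := ProjectiveResolution.lift g P' P
    hom_f_zero_comp_π_f_zero := ProjectiveResolution.lift_commutes_zero g P' P }
  obtain ⟨z, rfl⟩ := extOfCocycle_surjective P n Y x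
  have h : ((Abelian.Ext.mk₀ g).comp (extOfCocycle P n Y z) (zero_add n)) =
    extOfCocycle P' n Y (cyclesMap (linearYonedaObjMap φ.hom Y) n z) := by
    refine (ProjectiveResolution.mk₀_comp_extMk (cocycleHom P n Y z) (n + 1) rfl
      (d_comp_cocycleHom P n Y z) φ).trans (extMk_congr P' ?_ _ (d_comp_cocycleHom P' n Y _))
    exact ConcreteCategory.congr_hom (cyclesMap_i (linearYonedaObjMap φ.hom Y) n).symm z
  rw [h]
  have h' := ConcreteCategory.congr_hom (extMod_map_isoExt g P P' φ n Y)
    (extEquivExtMod P n Y (extOfCocycle P n Y z))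
  apply (P'.isoExt n Y).toLinearEquiv.injective
  refine Eq.trans ?_ h'.symm
  have e1 : ∀ (X : ModuleCat.{u} R) (P : ProjectiveResolution X) (w : _),
    (P.isoExt n Y).hom (extEquivExtMod P n Y (extOfCocycle P n Y w)) =
    (P.complex.linearYonedaObj R Y).homologyπ n w := by
    intro X P w
    rw [← extEquivHomology_extOfCocycle]
    exact (P.isoExt n Y).toLinearEquiv.apply_symm_apply _
  refine (e1 _ P' _).trans ?_
  refine Eq.trans ?_ ((ConcreteCategory.comp_apply (P.isoExt n Y).hom
    (homologyMap (linearYonedaObjMap φ.hom Y) n) _).trans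
      (congrArg (homologyMap (linearYonedaObjMap φ.hom Y) n) (e1 X P z))).symm
  exact ConcreteCategory.congr_hom (homologyπ_naturality (linearYonedaObjMap φ.hom Y) n).symm z

end comparison

section colimit

open Limits Abelian Opposite localCohomology

variable {R : Type u} [CommRing R]

/-- The projection `R/a^s ⟶ R/a^t` for `t ≤ s`. -/
def quotPowMap (a : Ideal R) {t s : ℕ} (h : t ≤ s) :
    ModuleCat.of R (R ⧸ a ^ s) ⟶ ModuleCat.of R (R ⧸ a ^ t) :=
  ModuleCat.ofHom (Submodule.mapQ _ _ LinearMap.id (Ideal.pow_le_pow_right h))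

/-- Every class in `Ext^j(R/a^t, L)` dies in some `Ext^j(R/a^s, L)`, i.e. the direct limit defining
`H^j_a(L)` is zero. -/
def LocalCohVanishes (a : Ideal R) (j : ℕ) (L : ModuleCat.{u} R) : Prop :=
  ∀ (t : ℕ) (x : Abelian.Ext (ModuleCat.of R (R ⧸ a ^ t)) L j), ∃ (s : ℕ) (h : t ≤ s),
    (Abelian.Ext.mk₀ (quotPowMap a h)).comp x (zero_add j) = 0

lemma localCohomology_subsingleton_iff (a : Ideal R) (j : ℕ) (L : ModuleCat.{u} R) :
    Subsingleton ((localCohomology a j).obj L) ↔ LocalCohVanishes a j L := by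
  have hasCol := hasColimitDiagram.{u, 0} (idealPowersDiagram a) j
  let F := diagram (idealPowersDiagram a) j
  let G : (ℕᵒᵖ)ᵒᵖ ⥤ ModuleCat.{u} R := F ⋙ (evaluation _ _).obj L
  let c : Cocone G := ((evaluation _ _).obj L).mapCocone (colimit.cocone F)
  have hc : IsColimit c := isColimitOfPreserves _ (colimit.isColimit F)
  have hpt : c.pt = (localCohomology a j).obj L := rfl
  rw [← hpt]
  let e : ∀ t : ℕ, Abelian.Ext (ModuleCat.of R (R ⧸ a ^ t)) L j ≃ₗ[R] G.obj (op (op t)) := fun t ↦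
    extEquivExtMod (projectiveResolution (ModuleCat.of R (R ⧸ a ^ t))) j L
  have he : ∀ (t s : ℕ) (h : t ≤ s) (x : Abelian.Ext (ModuleCat.of R (R ⧸ a ^ t)) L j),
      e s ((Abelian.Ext.mk₀ (quotPowMap a h)).comp x (zero_add j)) =
        G.map (homOfLE h).op.op (e t x) := fun t s h x ↦
    extEquivExtMod_naturality (quotPowMap a h) _ _ j L x
  have : IsFiltered (ℕᵒᵖ)ᵒᵖ := inferInstance
  have : PreservesFilteredColimitsOfSize.{0, 0} (forget (ModuleCat.{u} R)) :=
    preservesFilteredColimitsOfSize_shrink.{0, u, 0, u} _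
  constructor
  · intro hs t x
    obtain ⟨k, f, g, hk⟩ := Concrete.isColimit_exists_of_rep_eq G hc (e t x) (0 : G.obj (op (op t)))
      (hs.elim _ _)
    obtain ⟨s, rfl⟩ : ∃ s : ℕ, op (op s) = k := ⟨k.unop.unop, rfl⟩
    have hts : t ≤ s := f.unop.unop.down.down
    refine ⟨s, hts, (e s).injective ?_⟩
    rw [he, map_zero]
    refine Eq.trans ?_ (hk.trans (map_zero (G.map g).hom))
    rfl
  · intro hv
    refine ⟨fun p q ↦ ?_⟩
    have h0 : ∀ p : c.pt, p = 0 := by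
      intro p
      obtain ⟨k, y, rfl⟩ := Concrete.isColimit_exists_rep G hc p
      obtain ⟨t, rfl⟩ : ∃ t : ℕ, op (op t) = k := ⟨k.unop.unop, rfl⟩
      obtain ⟨x, rfl⟩ := (e t).surjective y
      obtain ⟨s, h, hx⟩ := hv t x
      rw [← c.w (homOfLE h).op.op, ConcreteCategory.comp_apply, ← he, hx, map_zero, map_zero]
    rw [h0 p, h0 q]

end colimit

section exactSequence

open Limits Abelian

variable {R : Type u} [CommRing R] {a : Ideal R}

lemma quotPowMap_comp (a : Ideal R) {t s r : ℕ} (h : t ≤ s) (h' : s ≤ r) :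
    quotPowMap a h' ≫ quotPowMap a h = quotPowMap a (h.trans h') := by
  ext
  rfl

lemma mk₀_quotPowMap_comp (a : Ideal R) {L : ModuleCat.{u} R} {j t s r : ℕ} (h : t ≤ s)
    (h' : s ≤ r) (x : Abelian.Ext (ModuleCat.of R (R ⧸ a ^ t)) L j) :
    (Abelian.Ext.mk₀ (quotPowMap a (h.trans h'))).comp x (zero_add j) =
      (Abelian.Ext.mk₀ (quotPowMap a h')).comp
        ((Abelian.Ext.mk₀ (quotPowMap a h)).comp x (zero_add j)) (zero_add j) := by
  rw [Ext.mk₀_comp_mk₀_assoc, quotPowMap_comp]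

namespace LocalCohVanishes

variable {S : ShortComplex (ModuleCat.{u} R)} {j : ℕ}

lemma middle (hS : S.ShortExact) (h₁ : LocalCohVanishes a j S.X₁) (h₃ : LocalCohVanishes a j S.X₃) :
    LocalCohVanishes a j S.X₂ := by
  intro t x
  obtain ⟨s, hs, hx⟩ := h₃ t (x.comp (Ext.mk₀ S.g) (add_zero j))
  obtain ⟨y, hy⟩ := Ext.covariant_sequence_exact₂ _ hS
    ((Ext.mk₀ (quotPowMap a hs)).comp x (zero_add j)) (by rw [Ext.comp_assoc_of_third_deg_zero, hx])
  obtain ⟨r, hr, hy'⟩ := h₁ s y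
  refine ⟨r, hs.trans hr, ?_⟩
  rw [mk₀_quotPowMap_comp a hs hr, ← hy, ← Ext.comp_assoc_of_third_deg_zero, hy', Ext.zero_comp]

lemma right (hS : S.ShortExact) (h₂ : LocalCohVanishes a j S.X₂)
    (h₁ : LocalCohVanishes a (j + 1) S.X₁) : LocalCohVanishes a j S.X₃ := by
  intro t x
  obtain ⟨s, hs, hx⟩ := h₁ t (x.comp hS.extClass rfl)
  obtain ⟨y, hy⟩ := Ext.covariant_sequence_exact₃ _ hS
    ((Ext.mk₀ (quotPowMap a hs)).comp x (zero_add j)) rfl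
    (by rw [Ext.comp_assoc _ _ _ (zero_add j) rfl (by lia), hx])
  obtain ⟨r, hr, hy'⟩ := h₂ s y
  refine ⟨r, hs.trans hr, ?_⟩
  rw [mk₀_quotPowMap_comp a hs hr, ← hy, ← Ext.comp_assoc_of_third_deg_zero, hy', Ext.zero_comp]

lemma exists_of_comp_eq_zero (hS : S.ShortExact) (h₃ : LocalCohVanishes a j S.X₃) {t : ℕ}
    (x : Abelian.Ext (ModuleCat.of R (R ⧸ a ^ t)) S.X₁ (j + 1))
    (hx : x.comp (Ext.mk₀ S.f) (add_zero _) = 0) :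
    ∃ (s : ℕ) (h : t ≤ s), (Ext.mk₀ (quotPowMap a h)).comp x (zero_add _) = 0 := by
  obtain ⟨y, rfl⟩ := Ext.covariant_sequence_exact₁ _ hS x hx rfl
  obtain ⟨r, hr, hy⟩ := h₃ t y
  exact ⟨r, hr, by rw [← Ext.comp_assoc _ _ _ (zero_add j) rfl (by lia), hy, Ext.zero_comp]⟩

lemma left (hS : S.ShortExact) (h₃ : LocalCohVanishes a j S.X₃)
    (h₂ : LocalCohVanishes a (j + 1) S.X₂) : LocalCohVanishes a (j + 1) S.X₁ := by
  intro t x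
  obtain ⟨s, hs, hx⟩ := h₂ t (x.comp (Ext.mk₀ S.f) (add_zero _))
  obtain ⟨r, hr, hy⟩ := exists_of_comp_eq_zero hS h₃
    ((Ext.mk₀ (quotPowMap a hs)).comp x (zero_add _)) (by rw [Ext.comp_assoc_of_third_deg_zero, hx])
  exact ⟨r, hs.trans hr, by rw [mk₀_quotPowMap_comp a hs hr, hy]⟩

lemma of_iso {L L' : ModuleCat.{u} R} (e : L ≅ L') (h : LocalCohVanishes a j L) :
    LocalCohVanishes a j L' := by
  intro t x
  obtain ⟨s, hs, hx⟩ := h t (x.comp (Ext.mk₀ e.inv) (add_zero j))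
  refine ⟨s, hs, ?_⟩
  have := congrArg (fun z ↦ z.comp (Ext.mk₀ e.hom) (add_zero j)) hx
  simpa [Ext.comp_assoc_of_third_deg_zero] using this

lemma of_subsingleton {L : ModuleCat.{u} R} [Subsingleton L] : LocalCohVanishes a j L := by
  intro t x
  refine ⟨t, le_rfl, ?_⟩
  have h : 𝟙 L = 0 := by
    ext x
    exact Subsingleton.elim _ _
  rw [← x.comp_mk₀_id, h, Ext.mk₀_zero, Ext.comp_zero, Ext.comp_zero]

lemma of_injective {L : ModuleCat.{u} R} [Injective L] : LocalCohVanishes a (j + 1) L := by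
  intro t x
  refine ⟨t, le_rfl, ?_⟩
  rw [x.eq_zero_of_injective, Ext.comp_zero]

end LocalCohVanishes

end exactSequence

section filtration

open Limits Abelian

variable {R : Type u} [CommRing R]

/-- A finitely generated module inherits vanishing from the quotients `R/p`, `p ⊇ Ann L`. -/
lemma LocalCohVanishes.of_forall_prime [IsNoetherianRing R] {a : Ideal R} {j : ℕ}
    (L : Type u) [AddCommGroup L] [Module R L] [hL : Module.Finite R L]
    (h : ∀ p : PrimeSpectrum R, Module.annihilator R L ≤ p.asIdeal →
      LocalCohVanishes a j (ModuleCat.of R (R ⧸ p.asIdeal))) :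
    LocalCohVanishes a j (ModuleCat.of R L) := by
  induction hL using IsNoetherianRing.induction_on_isQuotientEquivQuotientPrime with
  | subsingleton N => exact of_subsingleton
  | quotient N p e =>
    refine of_iso e.toModuleIso.symm (h p ?_)
    rw [e.annihilator_eq, Ideal.annihilator_quotient]
  | exact N₁ N₂ N₃ f g hf hg hfg h₁ h₃ =>
    exact middle (S := ModuleCat.shortComplexOfCompEqZero f g hfg.linearMap_comp_eq_zero)
      (ModuleCat.shortComplex_shortExact _ hfg hf hg)
      (h₁ fun p hp ↦ h p ((f.annihilator_le_of_injective hf).trans hp))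
      (h₃ fun p hp ↦ h p ((g.annihilator_le_of_surjective hg).trans hp))

end filtration

section torsion

open Limits Abelian

variable {R : Type u} [CommRing R]

/-- The submodule `Γ_a(E)` of elements killed by some power of `a`. -/
def powTorsion (a : Ideal R) (E : Type u) [AddCommGroup E] [Module R E] : Submodule R E where
  carrier := {x | ∃ n : ℕ, ∀ r ∈ a ^ n, r • x = 0}
  zero_mem' := ⟨0, fun r _ ↦ smul_zero r⟩
  add_mem' := by
    rintro x y ⟨n, hn⟩ ⟨m, hm⟩
    refine ⟨n + m, fun r hr ↦ ?_⟩
    rw [smul_add, hn r (Ideal.pow_le_pow_right (n.le_add_right m) hr),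
      hm r (Ideal.pow_le_pow_right (m.le_add_left n) hr), add_zero]
  smul_mem' := by
    rintro c x ⟨n, hn⟩
    exact ⟨n, fun r hr ↦ by rw [smul_comm, hn r hr, smul_zero]⟩

variable {a : Ideal R} {E : Type u} [AddCommGroup E] [Module R E]

lemma exists_pow_smul_eq_zero_of_finite {P : Type*} [AddCommGroup P] [Module R P]
    [Module.Finite R P] (g : P →ₗ[R] E) (hg : ∀ x, g x ∈ powTorsion a E) :
    ∃ n : ℕ, ∀ r ∈ a ^ n, ∀ x, r • g x = 0 := by
  obtain ⟨S, hS⟩ := Module.Finite.fg_top (R := R) (M := P)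
  choose n hn using hg
  refine ⟨S.sup n, fun r hr x ↦ ?_⟩
  have hx : x ∈ Submodule.span R (S : Set P) := hS ▸ Submodule.mem_top
  induction hx using Submodule.span_induction with
  | mem x hx => exact hn x r (Ideal.pow_le_pow_right (Finset.le_sup hx) hr)
  | zero => simp
  | add x y _ _ hx hy => rw [map_add, smul_add, hx, hy, add_zero]
  | smul c x _ hx => rw [map_smul, smul_comm, hx, smul_zero]

lemma injective_powTorsion [IsNoetherianRing R] (a : Ideal R) (E : Type u) [AddCommGroup E]
    [Module R E] [hE : Module.Injective R E] : Module.Injective R (powTorsion a E) := by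
  refine Module.Baer.injective fun I g ↦ ?_
  obtain ⟨n, hn⟩ := exists_pow_smul_eq_zero_of_finite ((powTorsion a E).subtype ∘ₗ g)
    (fun x ↦ (g x).2)
  obtain ⟨k, hk⟩ := Ideal.exists_pow_inf_eq_pow_smul (M := R) a I
  let m := n + k
  let K : Submodule R I := Submodule.comap I.subtype (a ^ m)
  have hK : K ≤ LinearMap.ker ((powTorsion a E).subtype ∘ₗ g) := by
    intro x hx
    have hx' : (x : R) ∈ a ^ n • I := by
      have h := hk m (Nat.le_add_left k n)
      rw [show m - k = n from Nat.add_sub_cancel n k] at h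
      have hx₁ : (x : R) ∈ a ^ m • (⊤ : Submodule R R) ⊓ I :=
        ⟨by rw [smul_eq_mul, Ideal.mul_top]; exact hx, x.2⟩
      rw [h] at hx₁
      exact Submodule.smul_mono le_rfl inf_le_right hx₁
    have key : ∀ y ∈ a ^ n • I, ∃ hy : y ∈ I, ((powTorsion a E).subtype ∘ₗ g) ⟨y, hy⟩ = 0 := by
      intro y hy
      refine Submodule.smul_induction_on hy (fun r hr z hz ↦ ⟨I.smul_mem r hz, ?_⟩) ?_
      · exact (map_smul _ r (⟨z, hz⟩ : I)).trans (hn r hr ⟨z, hz⟩)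
      · rintro y z ⟨hy, hy'⟩ ⟨hz, hz'⟩
        exact ⟨I.add_mem hy hz, (map_add _ (⟨y, hy⟩ : I) ⟨z, hz⟩).trans
          (by rw [hy', hz', add_zero])⟩
    exact (key x hx').2
  let i : (I ⧸ K) →ₗ[R] (R ⧸ a ^ m) := Submodule.mapQ K (a ^ m) I.subtype le_rfl
  have hi : Function.Injective i := by
    rw [← LinearMap.ker_eq_bot, Submodule.ker_mapQ]
    simp [K]
  obtain ⟨h, hh⟩ := hE.out i hi (K.liftQ _ hK)
  have he : h (Submodule.Quotient.mk 1) ∈ powTorsion a E := by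
    refine ⟨m, fun r hr ↦ ?_⟩
    rw [← map_smul, ← Submodule.Quotient.mk_smul, smul_eq_mul, mul_one,
      (Submodule.Quotient.mk_eq_zero _).2 hr, map_zero]
  refine ⟨LinearMap.toSpanSingleton R _ ⟨_, he⟩, fun x hx ↦ Subtype.ext ?_⟩
  refine Eq.trans ?_ (hh (Submodule.Quotient.mk ⟨x, hx⟩))
  rw [LinearMap.toSpanSingleton_apply, Submodule.coe_smul, ← map_smul, ← Submodule.Quotient.mk_smul,
    smul_eq_mul, mul_one]
  rfl

lemma exists_lift_of_powTorsion_eq_top {T Q : ModuleCat.{u} R} (hT : powTorsion a T = ⊤)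
    (g : T ⟶ Q) (hg : Function.Surjective g) {t : ℕ} (u : ModuleCat.of R (R ⧸ a ^ t) ⟶ Q) :
    ∃ (s : ℕ) (h : t ≤ s) (v : ModuleCat.of R (R ⧸ a ^ s) ⟶ T), quotPowMap a h ≫ u = v ≫ g := by
  obtain ⟨γ, hγ⟩ := hg (u (Submodule.Quotient.mk 1))
  obtain ⟨n, hn⟩ : γ ∈ powTorsion a T := hT ▸ Submodule.mem_top
  refine ⟨t + n, t.le_add_right n, ModuleCat.ofHom (Submodule.liftQ _
    (LinearMap.toSpanSingleton R T γ) fun r hr ↦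
      hn r (Ideal.pow_le_pow_right (n.le_add_left t) hr)), ?_⟩
  ext
  refine hγ.symm.trans (congrArg g ?_)
  exact (one_smul R γ).symm

lemma exists_shortExact_powTorsion_eq_top [IsNoetherianRing R] (L : ModuleCat.{u} R)
    (hL : powTorsion a L = ⊤) : ∃ S : ShortComplex (ModuleCat.{u} R), S.ShortExact ∧ S.X₁ = L ∧
      Injective S.X₂ ∧ powTorsion a S.X₂ = ⊤ ∧ powTorsion a S.X₃ = ⊤ := by
  let E := Injective.under L
  have hE : Module.Injective R E := Module.injective_iff_injective_object R E |>.2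
    (inferInstanceAs (Injective (Injective.under L)))
  let f : L →ₗ[R] powTorsion a E := LinearMap.codRestrict _ (Injective.ι L).hom fun x ↦ by
    obtain ⟨n, hn⟩ : x ∈ powTorsion a L := hL ▸ Submodule.mem_top
    exact ⟨n, fun r hr ↦ by rw [← map_smul, hn r hr, map_zero]⟩
  have hf : Function.Injective f := fun x y hxy ↦
    (ModuleCat.mono_iff_injective (Injective.ι L)).1 inferInstance (congrArg Subtype.val hxy)
  have hΓ : powTorsion a (powTorsion a E) = ⊤ := by
    refine eq_top_iff.2 fun x _ ↦ ?_
    obtain ⟨n, hn⟩ := x.2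
    exact ⟨n, fun r hr ↦ Subtype.ext (hn r hr)⟩
  refine ⟨ModuleCat.shortComplexOfCompEqZero f (LinearMap.range f).mkQ (by ext; simp),
    ModuleCat.shortComplex_shortExact _ (LinearMap.exact_map_mkQ_range f) hf
      (Submodule.mkQ_surjective _), rfl, ?_, hΓ, ?_⟩
  · have := injective_powTorsion a E
    exact Module.injective_iff_injective_object R _ |>.1 this
  · refine eq_top_iff.2 fun x _ ↦ ?_
    obtain ⟨y, rfl⟩ := Submodule.mkQ_surjective _ x
    obtain ⟨n, hn⟩ : y ∈ powTorsion a (powTorsion a E) := hΓ ▸ Submodule.mem_top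
    exact ⟨n, fun r hr ↦ by rw [← map_smul, hn r hr, map_zero]⟩

lemma LocalCohVanishes.of_powTorsion_eq_top [IsNoetherianRing R] (j : ℕ) (L : ModuleCat.{u} R)
    (hL : powTorsion a L = ⊤) : LocalCohVanishes a (j + 1) L := by
  induction j generalizing L with
  | zero =>
    obtain ⟨S, hS, rfl, _, h₂, -⟩ := exists_shortExact_powTorsion_eq_top L hL
    intro t x
    obtain ⟨y, rfl⟩ := Ext.covariant_sequence_exact₁ _ hS x (Ext.eq_zero_of_injective _) rfl
    obtain ⟨u, rfl⟩ := Ext.homEquiv₀.symm.surjective y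
    obtain ⟨s, hs, v, hv⟩ := exists_lift_of_powTorsion_eq_top h₂ S.g hS.moduleCat_surjective_g u
    refine ⟨s, hs, ?_⟩
    rw [← Ext.comp_assoc _ _ _ (zero_add 0) rfl (by lia)]
    change ((Ext.mk₀ (quotPowMap a hs)).comp (Ext.mk₀ u) _).comp _ _ = 0
    rw [Ext.mk₀_comp_mk₀, hv, ← Ext.mk₀_comp_mk₀, Ext.comp_assoc _ _ _ (zero_add 0) rfl (by lia),
      hS.comp_extClass, Ext.comp_zero]
  | succ j ih =>
    obtain ⟨S, hS, rfl, _, -, h₃⟩ := exists_shortExact_powTorsion_eq_top L hL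
    exact left hS (ih _ h₃) of_injective

end torsion

section nonzeroHom

variable {R : Type u} [CommRing R]

lemma exists_hom_quotient_prime_ne_zero (N : Type u) [AddCommGroup N] [Module R N]
    [Module.Finite R N] (p : PrimeSpectrum R) (hp : Module.annihilator R N ≤ p.asIdeal) :
    ∃ f : N →ₗ[R] R ⧸ p.asIdeal, f ≠ 0 := by
  let κ := p.asIdeal.ResidueField
  have hnt : Nontrivial (κ ⊗[R] N) :=
    Module.mem_support_iff_nontrivial_residueField_tensorProduct p |>.1
      (Module.mem_support_iff_of_finite.2 hp)
  obtain ⟨x, hx⟩ := exists_ne (0 : κ ⊗[R] N)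
  obtain ⟨φ, hφ⟩ : ∃ φ : Module.Dual κ (κ ⊗[R] N), φ x ≠ 0 := by
    by_contra! h
    exact hx ((Module.forall_dual_apply_eq_zero_iff κ x).1 h)
  let ψ : N →ₗ[R] κ := φ.restrictScalars R ∘ₗ TensorProduct.mk R κ N 1
  obtain ⟨n₀, hn₀⟩ : ∃ n, ψ n ≠ 0 := by
    by_contra! h
    have h0 : ∀ y, φ y = 0 := by
      intro y
      induction y with
      | zero => exact map_zero φ
      | tmul c n =>
        rw [← mul_one c, ← smul_eq_mul, ← TensorProduct.smul_tmul', map_smul]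
        exact (congrArg (c • ·) (h n)).trans (smul_zero c)
      | add y z hy hz => rw [map_add, hy, hz, add_zero]
    exact hφ (h0 x)
  let ι : (R ⧸ p.asIdeal) →ₗ[R] κ := (IsScalarTower.toAlgHom R (R ⧸ p.asIdeal) κ).toLinearMap
  have hι : Function.Injective ι := IsFractionRing.injective (R ⧸ p.asIdeal) κ
  obtain ⟨S, hS⟩ := Module.Finite.fg_top (R := R) (M := N)
  obtain ⟨⟨b, hb₀⟩, hb⟩ := IsLocalization.exist_integer_multiples
    (nonZeroDivisors (R ⧸ p.asIdeal)) S ψ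
  obtain ⟨r, rfl⟩ := Ideal.Quotient.mk_surjective b
  have hr : ∀ n, (r • ψ) n ∈ LinearMap.range ι := by
    intro n
    have hn : n ∈ Submodule.span R (S : Set N) := hS ▸ Submodule.mem_top
    induction hn using Submodule.span_induction with
    | mem n hn =>
      obtain ⟨c, hc⟩ := hb n hn
      exact ⟨c, hc.trans (algebraMap_smul (R ⧸ p.asIdeal) r (ψ n))⟩
    | zero => simp
    | add x y _ _ hx hy => rw [map_add]; exact add_mem hx hy
    | smul c x _ hx => rw [map_smul]; exact Submodule.smul_mem _ c hx
  refine ⟨(LinearEquiv.ofInjective ι hι).symm.toLinearMap ∘ₗ (r • ψ).codRestrict _ hr, fun h ↦ ?_⟩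
  have h₁ := LinearMap.congr_fun h n₀
  have h₂ : (r • ψ).codRestrict _ hr n₀ = 0 :=
    (LinearEquiv.ofInjective ι hι).symm.injective (h₁.trans (map_zero _).symm)
  have h₃ : r • ψ n₀ = 0 := congrArg Subtype.val h₂
  rw [← algebraMap_smul (R ⧸ p.asIdeal), smul_eq_zero] at h₃
  exact h₃.elim (nonZeroDivisors.ne_zero hb₀) hn₀

end nonzeroHom

section vanishing

open Limits Abelian

variable {R : Type u} [CommRing R]

lemma ext_smul_eq_zero_of_mem_annihilator_left {X Y : ModuleCat.{u} R} {n : ℕ} {r : R}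
    (hr : r ∈ Module.annihilator R X) (x : Abelian.Ext X Y n) : r • x = 0 := by
  have h : r • 𝟙 X = 0 := by
    ext z
    exact Module.mem_annihilator.1 hr z
  rw [← x.mk₀_id_comp, ← Ext.smul_comp, ← Ext.mk₀_smul, h, Ext.mk₀_zero, Ext.zero_comp]

lemma ext_smul_eq_zero_of_mem_annihilator_right {X Y : ModuleCat.{u} R} {n : ℕ} {r : R}
    (hr : r ∈ Module.annihilator R Y) (x : Abelian.Ext X Y n) : r • x = 0 := by
  have h : r • 𝟙 Y = 0 := by
    ext z
    exact Module.mem_annihilator.1 hr z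
  rw [← x.comp_mk₀_id, ← Ext.comp_smul, ← Ext.mk₀_smul, h, Ext.mk₀_zero, Ext.comp_zero]

lemma mem_annihilator_quotSMulTop (y : R) (M : Type u) [AddCommGroup M] [Module R M] :
    y ∈ Module.annihilator R (QuotSMulTop y M) := by
  refine Module.mem_annihilator.2 fun z ↦ ?_
  obtain ⟨z, rfl⟩ := Submodule.mkQ_surjective _ z
  rw [← map_smul]
  exact (Submodule.Quotient.mk_eq_zero _).2
    (Submodule.smul_mem_pointwise_smul z y ⊤ Submodule.mem_top)

lemma annihilator_le_annihilator_quotSMulTop (y : R) (M : Type u) [AddCommGroup M] [Module R M] :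
    Module.annihilator R M ≤ Module.annihilator R (QuotSMulTop y M) :=
  LinearMap.annihilator_le_of_surjective (Submodule.mkQ _) (Submodule.mkQ_surjective _)

lemma isSMulRegular_quotient_of_notMem (p : PrimeSpectrum R) {y : R} (hy : y ∉ p.asIdeal) :
    IsSMulRegular (R ⧸ p.asIdeal) y := by
  refine isSMulRegular_iff_right_eq_zero_of_smul.2 fun z hz ↦ ?_
  obtain ⟨z, rfl⟩ := Ideal.Quotient.mk_surjective z
  have : y * z ∈ p.asIdeal := (Submodule.Quotient.mk_eq_zero _).1 hz
  exact Ideal.Quotient.eq_zero_iff_mem.2 ((p.2.mem_or_mem this).resolve_left hy)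

variable [IsNoetherianRing R] {a : Ideal R}

namespace LocalCohVanishes

/-- Grothendieck vanishing for `R/p`. -/
lemma quotient_prime_of_coheight_lt (n : ℕ) (p : PrimeSpectrum R) (hp : Order.coheight p < n)
    (j : ℕ) (hj : n ≤ j) : LocalCohVanishes a j (ModuleCat.of R (R ⧸ p.asIdeal)) := by
  induction n generalizing p j with
  | zero => simp at hp
  | succ n ih =>
    obtain ⟨j, rfl⟩ : ∃ i, j = i + 1 := ⟨j - 1, by lia⟩
    by_cases hap : a ≤ p.asIdeal
    · refine of_powTorsion_eq_top j _ (eq_top_iff.2 fun x _ ↦ ⟨1, fun r hr ↦ ?_⟩)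
      obtain ⟨x, rfl⟩ := Ideal.Quotient.mk_surjective x
      rw [pow_one] at hr
      exact (Submodule.Quotient.mk_eq_zero _).2 (p.asIdeal.mul_mem_right x (hap hr))
    · intro t x
      obtain ⟨y, hya, hyp⟩ := SetLike.not_le_iff_exists.1
        (fun h : a ^ t ≤ p.asIdeal ↦ hap (Ideal.IsPrime.le_of_pow_le h))
      have hreg : IsSMulRegular (ModuleCat.of R (R ⧸ p.asIdeal)) y :=
        isSMulRegular_quotient_of_notMem p hyp
      refine exists_of_comp_eq_zero hreg.smulShortComplex_shortExact ?_ x ?_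
      · refine of_forall_prime (QuotSMulTop y (R ⧸ p.asIdeal)) fun q hq ↦ ih q ?_ j (by lia)
        have hy : y ∈ q.asIdeal := hq (mem_annihilator_quotSMulTop y _)
        have hle : p.asIdeal ≤ q.asIdeal := Ideal.annihilator_quotient.ge.trans
          ((annihilator_le_annihilator_quotSMulTop y _).trans hq)
        have hpq : p < q := lt_of_le_of_ne hle (fun h ↦ hyp (h ▸ hy))
        have h₁ := (Order.coheight_add_one_le hpq).trans_lt hp
        push_cast at h₁
        exact lt_of_add_lt_add_right h₁
      · exact (Ext.smul_eq_comp_mk₀ x y).symm.trans (ext_smul_eq_zero_of_mem_annihilator_left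
          ((Ideal.annihilator_quotient (I := a ^ t)).symm ▸ hya) x)

lemma quotient_prime_of_succ {N : Type u} [AddCommGroup N] [Module R N] [Module.Finite R N] {j : ℕ}
    (hN : LocalCohVanishes a j (ModuleCat.of R N))
    (h : ∀ p : PrimeSpectrum R, Module.annihilator R N ≤ p.asIdeal →
      LocalCohVanishes a (j + 1) (ModuleCat.of R (R ⧸ p.asIdeal)))
    (p : PrimeSpectrum R) (hp : Module.annihilator R N ≤ p.asIdeal) :
    LocalCohVanishes a j (ModuleCat.of R (R ⧸ p.asIdeal)) := by
  have : WellFoundedGT (PrimeSpectrum R) := StrictMono.wellFoundedGT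
    (f := PrimeSpectrum.asIdeal) (fun _ _ h ↦ h)
  induction p using WellFoundedGT.induction with
  | ind p ih =>
    obtain ⟨f, hf⟩ := exists_hom_quotient_prime_ne_zero N p hp
    have hJ : LocalCohVanishes a j (ModuleCat.of R (LinearMap.range f)) :=
      right (LinearMap.shortExact_shortComplexKer f.surjective_rangeRestrict) hN
        (of_forall_prime (LinearMap.ker f.rangeRestrict) fun q hq ↦ h q
          (((LinearMap.ker f.rangeRestrict).subtype.annihilator_le_of_injective
            (Submodule.subtype_injective _)).trans hq))
    refine middle (S := ModuleCat.shortComplexOfCompEqZero (LinearMap.range f).subtype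
      (LinearMap.range f).mkQ (by ext; simp)) (ModuleCat.shortComplex_shortExact _
        (LinearMap.exact_subtype_mkQ _) (Submodule.subtype_injective _)
        (Submodule.mkQ_surjective _)) hJ
        (of_forall_prime ((R ⧸ p.asIdeal) ⧸ LinearMap.range f) fun q hq ↦ ?_)
    have hle : p.asIdeal ≤ q.asIdeal := fun z hz ↦ hq <|
      (LinearMap.range f).mkQ.annihilator_le_of_surjective (Submodule.mkQ_surjective _)
        (by rwa [Ideal.annihilator_quotient])
    refine ih q (lt_of_le_of_ne hle ?_) (hp.trans hle)
    rintro rfl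
    refine hf (LinearMap.ext fun x ↦ ?_)
    obtain ⟨r, hr⟩ := Ideal.Quotient.mk_surjective (f x)
    have hrp : r ∈ p.asIdeal := hq <| Module.mem_annihilator.2 fun z ↦ by
      obtain ⟨z, rfl⟩ := Submodule.mkQ_surjective _ z
      obtain ⟨z, rfl⟩ := Ideal.Quotient.mk_surjective z
      rw [← map_smul]
      refine (Submodule.Quotient.mk_eq_zero _).2 ⟨z • x, ?_⟩
      rw [map_smul, ← hr]
      exact congrArg (Ideal.Quotient.mk p.asIdeal) (mul_comm z r)
    rw [← hr, Ideal.Quotient.eq_zero_iff_mem.2 hrp, LinearMap.zero_apply]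

lemma exists_forall_quotient_prime (hfin : ringKrullDim R ≠ ⊤) (a : Ideal R) :
    ∃ n : ℕ, ∀ (p : PrimeSpectrum R) (j : ℕ), n ≤ j →
      LocalCohVanishes a j (ModuleCat.of R (R ⧸ p.asIdeal)) := by
  obtain ⟨n, hn⟩ : ∃ n : ℕ, Order.krullDim (PrimeSpectrum R) ≤ n := by
    change Order.krullDim (PrimeSpectrum R) ≠ ⊤ at hfin
    generalize Order.krullDim (PrimeSpectrum R) = d at hfin ⊢
    cases d with
    | bot => exact ⟨0, bot_le⟩
    | coe d =>
      cases d with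
      | top => exact absurd rfl hfin
      | coe d => exact ⟨d, le_rfl⟩
  refine ⟨n + 1, fun p j hj ↦ quotient_prime_of_coheight_lt (n + 1) p ?_ j hj⟩
  have h : Order.coheight p ≤ n := by exact_mod_cast (Order.coheight_le_krullDim p).trans hn
  exact h.trans_lt (by exact_mod_cast n.lt_succ_self)

lemma of_annihilator_le (hfin : ringKrullDim R ≠ ⊤) {N : Type u} [AddCommGroup N] [Module R N]
    [Module.Finite R N] {j : ℕ} (hN : ∀ i, j ≤ i → LocalCohVanishes a i (ModuleCat.of R N))
    (L : Type u) [AddCommGroup L] [Module R L] [Module.Finite R L]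
    (hL : Module.annihilator R N ≤ Module.annihilator R L) :
    LocalCohVanishes a j (ModuleCat.of R L) := by
  obtain ⟨n, hn⟩ := exists_forall_quotient_prime hfin a
  have key : ∀ k i, j ≤ i → n ≤ i + k → ∀ p : PrimeSpectrum R,
      Module.annihilator R N ≤ p.asIdeal →
        LocalCohVanishes a i (ModuleCat.of R (R ⧸ p.asIdeal)) := by
    intro k
    induction k with
    | zero => exact fun i _ hi p _ ↦ hn p i hi
    | succ k ih =>
      exact fun i hji hi ↦ quotient_prime_of_succ (hN i hji) (ih (i + 1) (by lia) (by lia))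
  exact of_forall_prime L fun p hp ↦ key n j le_rfl (by lia) p (hL.trans hp)

end LocalCohVanishes

end vanishing

section extMod

open Limits Abelian

variable {R : Type u} [CommRing R]

lemma subsingleton_ext_of_projDimLE {M : ModuleCat.{u} R} {n : ℕ} (hM : projDimLE R M n) {i : ℕ}
    (hi : n < i) (N : ModuleCat.{u} R) : Subsingleton (Abelian.Ext M N i) := by
  induction i, hi using Nat.le_induction generalizing N with
  | base =>
    have := hM N
    exact (extEquivExtMod (projectiveResolution M) (n + 1) N).toEquiv.subsingleton
  | succ i hi ih =>
    have hS : (ShortComplex.mk _ _ (cokernel.condition (Injective.ι N))).ShortExact :=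
      { exact := ShortComplex.exact_of_g_is_cokernel _ (cokernelIsCokernel _) }
    have h0 : ∀ x : Abelian.Ext M N (i + 1), x = 0 := fun x ↦ by
      obtain ⟨y, rfl⟩ := Ext.covariant_sequence_exact₁ _ hS x (Ext.eq_zero_of_injective _) rfl
      have := ih (cokernel (Injective.ι N))
      rw [Subsingleton.elim y 0, Ext.zero_comp]
    exact ⟨fun x y ↦ (h0 x).trans (h0 y).symm⟩

lemma finite_extMod [IsNoetherianRing R] (M N : ModuleCat.{u} R) [Module.Finite R M]
    [Module.Finite R N] (i : ℕ) : Module.Finite R (extMod R i M N) :=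
  Module.Finite.equiv (extEquivExtMod (projectiveResolution M) i N)

lemma annihilator_le_annihilator_extMod (M N : ModuleCat.{u} R) (i : ℕ) :
    Module.annihilator R N ≤ Module.annihilator R (extMod R i M N) := by
  rw [← (extEquivExtMod (projectiveResolution M) i N).annihilator_eq]
  exact fun r hr ↦ Module.mem_annihilator.2 (ext_smul_eq_zero_of_mem_annihilator_right hr)

lemma le_projDim_of_not_subsingleton {M N : ModuleCat.{u} R} {i : ℕ}
    (h : ¬ Subsingleton (extMod R i M N)) : (i : WithBot ℕ∞) ≤ projDim R M := by
  refine le_sInf ?_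
  rintro _ ⟨n, rfl, hn⟩
  by_contra! hi
  have hi' : n < i := by exact_mod_cast hi
  have := subsingleton_ext_of_projDimLE hn hi' N
  exact h (extEquivExtMod (projectiveResolution M) i N).symm.toEquiv.subsingleton

lemma le_cohDim_of_annihilator_le [IsNoetherianRing R] (hfin : ringKrullDim R ≠ ⊤) (a : Ideal R)
    (N L : ModuleCat.{u} R) [Module.Finite R N] [Module.Finite R L]
    (hL : Module.annihilator R N ≤ Module.annihilator R L) {j : ℕ}
    (h : ¬ Subsingleton ((localCohomology a j).obj L)) : (j : WithBot ℕ∞) ≤ cohDim R a N := by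
  obtain ⟨i, hji, hi⟩ : ∃ i, j ≤ i ∧ ¬ Subsingleton ((localCohomology a i).obj N) := by
    by_contra! hN
    exact h ((localCohomology_subsingleton_iff a j L).2 (LocalCohVanishes.of_annihilator_le hfin
      (fun i hi ↦ (localCohomology_subsingleton_iff a i N).1 (hN i hi)) L hL))
  have hji' : (j : WithBot ℕ∞) ≤ i := by exact_mod_cast hji
  exact hji'.trans (le_iSup₂ (f := fun (i : ℕ) (_ : i ∈ {i : ℕ | ¬ Subsingleton
    ((localCohomology a i).obj N)}) ↦ (i : WithBot ℕ∞)) i hi)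

end extMod

/-- Theorem 3.2(i), module case: over a commutative Noetherian ring `R` of finite
Krull dimension, if `M`, `N` are finitely generated and `M` has finite projective
dimension, then `H^j_a(Ext^i_R(M, N)) ≠ 0` implies `i + j ≤ cd(a, N) + proj.dim_R M`. -/
theorem add_le_cohDim_add_projDim_of_localCohomology_ext_ne_zero (R : Type u) [CommRing R]
    [IsNoetherianRing R] (hfin : ringKrullDim R ≠ ⊤) (a : Ideal R)
    (M N : ModuleCat.{u} R) [Module.Finite R M] [Module.Finite R N]
    (hpd : ∃ n : ℕ, projDimLE R M n) (i j : ℕ)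
    (h : ¬ Subsingleton ((localCohomology a j).obj (extMod R i M N))) :
    ((i + j : ℕ) : WithBot ℕ∞) ≤ cohDim R a N + projDim R M := by

  have := finite_extMod M N i
  have h₁ : (j : WithBot ℕ∞) ≤ cohDim R a N :=
    le_cohDim_of_annihilator_le hfin a N _ (annihilator_le_annihilator_extMod M N i) h
  have h₂ : (i : WithBot ℕ∞) ≤ projDim R M := le_projDim_of_not_subsingleton (N := N) fun _ ↦
    h ((localCohomology_subsingleton_iff a j _).2 LocalCohVanishes.of_subsingleton)
  rw [add_comm i j, Nat.cast_add]
  exact add_le_add h₁ h₂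
end
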